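/- Let H be an N×N hermitian Wigner matrix satisfying condition C1, and let κ > 0. There exist a universal constant c₁ > 0 and positive constants C, c depending only on κ such that for any η with (log N)⁴/N ≤ η ≤ 1 and any δ ≤ c₁κ, P( sup_{E ∈ [−2+κ, 2−κ]} |m_N(E+iη) − m_sc(E+iη)| ≥ δ ) ≤ C e^{−c δ √(Nη)} for all N ≥ 2. -/

import Mathlib

open MeasureTheory ProbabilityTheory
open scoped ENNReal NNReal

noncomputable section

/-- The density of the Wigner semicircle law. -/
def rhoSC (x : ℝ) : ℝ := if |x| ≤ 2 then Real.sqrt (4 - x ^ 2) / (2 * Real.pi) else 0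

/-- The Stieltjes transform of the Wigner semicircle law. -/
def mSC (z : ℂ) : ℂ := ∫ x : ℝ, (rhoSC x : ℂ) / ((x : ℂ) - z)

/-- The Stieltjes transform of the empirical eigenvalue distribution of a matrix:
`m(z) = N⁻¹ Tr (H - z)⁻¹`. -/
def stTrans {N : ℕ} (A : Matrix (Fin N) (Fin N) ℂ) (z : ℂ) : ℂ :=
  (Matrix.trace (A - z • (1 : Matrix (Fin N) (Fin N) ℂ))⁻¹) / (N : ℂ)

open scoped Classical in
/-- The number of eigenvalues (with multiplicity) of a Hermitian matrix lying in a set `I`. -/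
def eigCount {N : ℕ} {A : Matrix (Fin N) (Fin N) ℂ} (hA : A.IsHermitian) (I : Set ℝ) : ℕ :=
  (Finset.univ.filter fun i => hA.eigenvalues i ∈ I).card

/-- `ν` has a strictly positive density `h` on `ℝ² ≃ ℂ` which is either a product of two copies
of a one-variable function or radially symmetric. -/
def WignerDensityOf (ν : Measure ℂ) (h : ℝ → ℝ → ℝ) : Prop :=
  (∀ x y, 0 < h x y) ∧
  ν = (volume : Measure ℂ).withDensity (fun z => ENNReal.ofReal (h z.re z.im)) ∧
  ((∃ hs : ℝ → ℝ, ∀ x y, h x y = hs x * hs y) ∨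
   (∃ hs : ℝ → ℝ, ∀ x y, h x y = hs (x ^ 2 + y ^ 2)))

/-- Condition C1, with explicit constants: Gaussian moments of the off-diagonal law `ν`
and of the diagonal law `ν'` are bounded by `D` resp. `D'`. -/
def CondC1 (ν : Measure ℂ) (ν' : Measure ℝ) (δ₀ D D' : ℝ) : Prop :=
  0 < δ₀ ∧
  (∫⁻ z, ENNReal.ofReal (Real.exp (δ₀ * ‖z‖ ^ 2)) ∂ν) ≤ ENNReal.ofReal D ∧
  (∫⁻ x, ENNReal.ofReal (Real.exp (δ₀ * x ^ 2)) ∂ν') ≤ ENNReal.ofReal D'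

/-- `H` is an `N × N` hermitian Wigner ensemble on the probability space `(Ω, P)`:
the entries above the diagonal are i.i.d. with law `N^{-1/2} ν` where `ν` has mean zero,
variance one and a density as in `WignerDensityOf`; the diagonal entries are real i.i.d.
with law `N^{-1/2} ν'`, `ν'` of mean zero; and all these entries are independent. -/
structure IsWignerMatrix {Ω : Type} [MeasurableSpace Ω] (P : Measure Ω) (N : ℕ)
    (H : Ω → Matrix (Fin N) (Fin N) ℂ) (ν : Measure ℂ) (ν' : Measure ℝ) : Prop where
  herm : ∀ ω, (H ω).IsHermitian
  prob : IsProbabilityMeasure P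
  probν : IsProbabilityMeasure ν
  probν' : IsProbabilityMeasure ν'
  density : ∃ h, WignerDensityOf ν h
  mean : (∫ z, z ∂ν) = 0
  var : (∫ z, ‖z‖ ^ 2 ∂ν) = 1
  mean' : (∫ x, x ∂ν') = 0
  offdiag : ∀ i j : Fin N, i < j →
    P.map (fun ω => (Real.sqrt N : ℂ) * H ω i j) = ν
  diag : ∀ i : Fin N, P.map (fun ω => Real.sqrt N * (H ω i i).re) = ν'
  diag_real : ∀ ω i, (H ω i i).im = 0
  indep : iIndepFun
    (fun (p : {p : Fin N × Fin N // p.1 ≤ p.2}) (ω : Ω) => H ω p.1.1 p.1.2) P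
/-- The Fourier transform on `ℝ²` of a real function of two variables. -/
def fourier2 (f : ℝ → ℝ → ℝ) (t s : ℝ) : ℂ :=
  ∫ x : ℝ, ∫ y : ℝ, Complex.exp (-Complex.I * (t * x + s * y)) * (f x y : ℂ)

/-- The Laplacian of a function of two real variables. -/
def laplacian2 (g : ℝ → ℝ → ℝ) (x y : ℝ) : ℝ :=
  deriv (deriv (fun t => g t y)) x + deriv (deriv (fun t => g x t)) y

/-- Condition C2 with exponent `a` and constants `w`, `w'`: decay of the Fourier transforms
of the density `h` and of `h · Δ(-log h)`. -/
def CondC2 (h : ℝ → ℝ → ℝ) (a : ℕ) (w w' : ℝ) : Prop :=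
  0 < w ∧ 0 < w' ∧
  (∀ t s : ℝ, ‖fourier2 h t s‖ ≤ 1 / (1 + w * (t ^ 2 + s ^ 2)) ^ a) ∧
  (∀ t s : ℝ, ‖fourier2
      (fun x y => h x y * laplacian2 (fun u v => -Real.log (h u v)) x y) t s‖
    ≤ 1 / (1 + w' * (t ^ 2 + s ^ 2)) ^ a)

/-- Either the real and imaginary parts under `ν` are i.i.d., or `ν` is rotationally
symmetric. -/
def ComplexSymm (ν : Measure ℂ) : Prop :=
  (∃ μ₀ : Measure ℝ,
    ν = Measure.map (fun p : ℝ × ℝ => (p.1 : ℂ) + p.2 * Complex.I) (μ₀.prod μ₀)) ∨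
  (∀ θ : ℝ, Measure.map (fun z => Complex.exp (θ * Complex.I) * z) ν = ν)
/-- Resolvent. -/
def rsv {N : ℕ} (A : Matrix (Fin N) (Fin N) ℂ) (z : ℂ) : Matrix (Fin N) (Fin N) ℂ :=
  (A - z • (1 : Matrix (Fin N) (Fin N) ℂ))⁻¹

lemma rsv_isUnit {N : ℕ} {A : Matrix (Fin N) (Fin N) ℂ} (hA : A.IsHermitian) {z : ℂ}
    (hz : 0 < z.im) : IsUnit (A - z • (1 : Matrix (Fin N) (Fin N) ℂ)).det := by
  rw [isUnit_iff_ne_zero]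
  intro h0
  obtain ⟨v, hv, hv0⟩ := Matrix.exists_mulVec_eq_zero_iff.2 h0
  rw [Matrix.sub_mulVec, Matrix.smul_mulVec, Matrix.one_mulVec, sub_eq_zero] at hv0
  have h1 : star v ⬝ᵥ (A.mulVec v) = z * (star v ⬝ᵥ v) := by
    rw [hv0, dotProduct_smul, smul_eq_mul]
  have h2 : (star v ⬝ᵥ (A.mulVec v)).im = 0 := hA.im_star_dotProduct_mulVec_self v
  have h3 : star v ⬝ᵥ v = ((∑ i, ‖v i‖ ^ 2 : ℝ) : ℂ) := by
    simp only [dotProduct, Pi.star_apply, RCLike.star_def]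
    push_cast
    refine Finset.sum_congr rfl fun i _ => ?_
    exact Complex.conj_mul' (v i)
  rw [h1, h3, Complex.mul_im, Complex.ofReal_re, Complex.ofReal_im] at h2
  have h4 : (∑ i, ‖v i‖ ^ 2 : ℝ) = 0 := by
    have : z.im * (∑ i, ‖v i‖ ^ 2 : ℝ) = 0 := by linarith
    rcases mul_eq_zero.1 this with h | h
    · exact absurd h hz.ne'
    · exact h
  apply hv
  funext i
  have := (Finset.sum_eq_zero_iff_of_nonneg (fun i _ => by positivity)).1 h4 i (Finset.mem_univ i)
  simpa using this

lemma rsv_mul {N : ℕ} {A : Matrix (Fin N) (Fin N) ℂ} (hA : A.IsHermitian) {z : ℂ}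
    (hz : 0 < z.im) : (A - z • (1 : Matrix (Fin N) (Fin N) ℂ)) * rsv A z = 1 :=
  Matrix.mul_nonsing_inv _ (rsv_isUnit hA hz)

lemma mul_rsv {N : ℕ} {A : Matrix (Fin N) (Fin N) ℂ} (hA : A.IsHermitian) {z : ℂ}
    (hz : 0 < z.im) : rsv A z * (A - z • (1 : Matrix (Fin N) (Fin N) ℂ)) = 1 :=
  Matrix.nonsing_inv_mul _ (rsv_isUnit hA hz)

lemma rsv_eq_of_mul {N : ℕ} {A B : Matrix (Fin N) (Fin N) ℂ} {z : ℂ}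
    (h : (A - z • (1 : Matrix (Fin N) (Fin N) ℂ)) * B = 1) : rsv A z = B :=
  Matrix.inv_eq_right_inv h

/-- `R Rᴴ` identity -/
lemma rsv_ward {N : ℕ} {A : Matrix (Fin N) (Fin N) ℂ} (hA : A.IsHermitian) {z : ℂ}
    (hz : 0 < z.im) : rsv A z - (rsv A z).conjTranspose =
      (2 * z.im * Complex.I) • (rsv A z * (rsv A z).conjTranspose) := by
  have h1 := mul_rsv hA hz
  have h2 : (A - (starRingEnd ℂ z) • (1 : Matrix (Fin N) (Fin N) ℂ)) * (rsv A z).conjTranspose = 1 := by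
    have := congrArg Matrix.conjTranspose h1
    rw [Matrix.conjTranspose_mul, Matrix.conjTranspose_sub, hA.eq] at this
    simpa using this
  set R := rsv A z
  have h3 : (2 * z.im * Complex.I) • (1 : Matrix (Fin N) (Fin N) ℂ) =
     (A - (starRingEnd ℂ z) • (1 : Matrix (Fin N) (Fin N) ℂ)) - (A - z • (1 : Matrix (Fin N) (Fin N) ℂ)) := by
    rw [sub_sub_sub_cancel_left, ← sub_smul]
    congr 1
    rw [Complex.sub_conj]; push_cast; ring
  calc R - R.conjTranspose = R * ((A - (starRingEnd ℂ z) • (1 : Matrix (Fin N) (Fin N) ℂ)) - (A - z • (1 : Matrix (Fin N) (Fin N) ℂ))) * R.conjTranspose := by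
        rw [mul_sub, sub_mul, h1, mul_assoc, h2, mul_one, one_mul]
    _ = _ := by rw [← h3]; simp

lemma rsv_ward' {N : ℕ} {A : Matrix (Fin N) (Fin N) ℂ} (hA : A.IsHermitian) {z : ℂ}
    (hz : 0 < z.im) : rsv A z - (rsv A z).conjTranspose =
      (2 * z.im * Complex.I) • ((rsv A z).conjTranspose * rsv A z) := by
  have h1 := rsv_mul hA hz
  have h2 : (rsv A z).conjTranspose * (A - (starRingEnd ℂ z) • (1 : Matrix (Fin N) (Fin N) ℂ)) = 1 := by
    have := congrArg Matrix.conjTranspose h1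
    rw [Matrix.conjTranspose_mul, Matrix.conjTranspose_sub, hA.eq] at this
    simpa using this
  set R := rsv A z
  have h3 : (2 * z.im * Complex.I) • (1 : Matrix (Fin N) (Fin N) ℂ) =
     (A - (starRingEnd ℂ z) • (1 : Matrix (Fin N) (Fin N) ℂ)) - (A - z • (1 : Matrix (Fin N) (Fin N) ℂ)) := by
    rw [sub_sub_sub_cancel_left, ← sub_smul]
    congr 1
    rw [Complex.sub_conj]; push_cast; ring
  calc R - R.conjTranspose = R.conjTranspose * ((A - (starRingEnd ℂ z) • (1 : Matrix (Fin N) (Fin N) ℂ)) - (A - z • (1 : Matrix (Fin N) (Fin N) ℂ))) * R := by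
        rw [mul_sub, sub_mul, h2, mul_assoc, h1, mul_one, one_mul]
    _ = _ := by rw [← h3]; simp

lemma rsv_row {N : ℕ} {A : Matrix (Fin N) (Fin N) ℂ} (hA : A.IsHermitian) {z : ℂ}
    (hz : 0 < z.im) (j : Fin N) : ∑ k, ‖rsv A z j k‖ ^ 2 = (rsv A z j j).im / z.im := by
  have h := congrFun (congrFun (rsv_ward hA hz) j) j
  simp only [Matrix.sub_apply, Matrix.conjTranspose_apply, Matrix.smul_apply, Matrix.mul_apply,
    RCLike.star_def, Complex.mul_conj', smul_eq_mul, Complex.sub_conj] at h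
  have h' := congrArg Complex.im h
  have e : (∑ x, (‖rsv A z j x‖ : ℂ) ^ 2) = ((∑ k, ‖rsv A z j k‖ ^ 2 : ℝ) : ℂ) := by push_cast; rfl
  rw [e] at h'
  rw [eq_div_iff hz.ne']
  generalize (∑ k, ‖rsv A z j k‖ ^ 2 : ℝ) = T at h'
  simp at h'
  linarith

lemma rsv_im_nonneg {N : ℕ} {A : Matrix (Fin N) (Fin N) ℂ} (hA : A.IsHermitian) {z : ℂ}
    (hz : 0 < z.im) (j : Fin N) : 0 ≤ (rsv A z j j).im := by
  have h := rsv_row hA hz j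
  have : 0 ≤ (rsv A z j j).im / z.im := h ▸ by positivity
  by_contra hc
  push Not at hc
  exact absurd this (not_le.2 (div_neg_of_neg_of_pos hc hz))

lemma rsv_diag_le {N : ℕ} {A : Matrix (Fin N) (Fin N) ℂ} (hA : A.IsHermitian) {z : ℂ}
    (hz : 0 < z.im) (j : Fin N) : ‖rsv A z j j‖ ≤ 1 / z.im := by
  have h := rsv_row hA hz j
  have h1 : ‖rsv A z j j‖ ^ 2 ≤ ∑ k, ‖rsv A z j k‖ ^ 2 :=
    Finset.single_le_sum (f := fun k => ‖rsv A z j k‖ ^ 2) (fun k _ => by positivity) (Finset.mem_univ j)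
  have h2 : (rsv A z j j).im ≤ ‖rsv A z j j‖ := (le_abs_self _).trans (Complex.abs_im_le_norm _)
  have h3 : ‖rsv A z j j‖ ^ 2 ≤ ‖rsv A z j j‖ / z.im := by
    rw [h] at h1; exact h1.trans (by gcongr)
  rcases (norm_nonneg (rsv A z j j)).eq_or_lt with h0 | h0
  · rw [← h0]; positivity
  · rw [le_div_iff₀ hz] at h3 ⊢
    nlinarith

lemma rsv_hs {N : ℕ} {A : Matrix (Fin N) (Fin N) ℂ} (hA : A.IsHermitian) {z : ℂ}
    (hz : 0 < z.im) : ∑ j, ∑ k, ‖rsv A z j k‖ ^ 2 = (Matrix.trace (rsv A z)).im / z.im := by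
  simp_rw [rsv_row hA hz, Matrix.trace, Matrix.diag, Complex.im_sum, Finset.sum_div]

lemma rsv_hs_le {N : ℕ} {A : Matrix (Fin N) (Fin N) ℂ} (hA : A.IsHermitian) {z : ℂ}
    (hz : 0 < z.im) : ∑ j, ∑ k, ‖rsv A z j k‖ ^ 2 ≤ N / z.im ^ 2 := by
  have : ∀ j, ∑ k, ‖rsv A z j k‖ ^ 2 ≤ 1 / z.im ^ 2 := by
    intro j
    rw [rsv_row hA hz j]
    have h2 : (rsv A z j j).im ≤ 1 / z.im :=
      ((le_abs_self _).trans (Complex.abs_im_le_norm _)).trans (rsv_diag_le hA hz j)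
    rw [div_le_div_iff₀ hz (by positivity)]
    rw [le_div_iff₀ hz] at h2
    nlinarith
  calc _ ≤ ∑ j : Fin N, 1 / z.im ^ 2 := Finset.sum_le_sum fun j _ => this j
    _ = _ := by simp; ring

lemma stTrans_eq {N : ℕ} (A : Matrix (Fin N) (Fin N) ℂ) (z : ℂ) :
    stTrans A z = (Matrix.trace (rsv A z)) / N := rfl

lemma stTrans_im_nonneg {N : ℕ} {A : Matrix (Fin N) (Fin N) ℂ} (hA : A.IsHermitian) {z : ℂ}
    (hz : 0 < z.im) : 0 ≤ (stTrans A z).im := by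
  rw [stTrans_eq, Complex.div_natCast_im, Matrix.trace, Complex.im_sum]
  exact div_nonneg (Finset.sum_nonneg fun j _ => rsv_im_nonneg hA hz j) (by positivity)

lemma stTrans_norm_le {N : ℕ} {A : Matrix (Fin N) (Fin N) ℂ} (hA : A.IsHermitian) {z : ℂ}
    (hz : 0 < z.im) : ‖stTrans A z‖ ≤ 1 / z.im := by
  rw [stTrans_eq, norm_div, Complex.norm_natCast, Matrix.trace]
  apply div_le_of_le_mul₀ (by positivity) (by positivity)
  calc _ ≤ ∑ j : Fin N, 1 / z.im := norm_sum_le_of_le _ fun j _ => rsv_diag_le hA hz j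
    _ = _ := by simp; ring

lemma stTrans_lip {N : ℕ} (hN : 0 < N) {A : Matrix (Fin N) (Fin N) ℂ} (hA : A.IsHermitian) {z w : ℂ}
    (hz : 0 < z.im) (hw : 0 < w.im) : ‖stTrans A z - stTrans A w‖ ≤ ‖z - w‖ / (z.im * w.im) := by
  have h1 : rsv A z - rsv A w = (z - w) • (rsv A z * rsv A w) := by
    have h3 : (z - w) • (1 : Matrix (Fin N) (Fin N) ℂ) =
     (A - w • (1 : Matrix (Fin N) (Fin N) ℂ)) - (A - z • (1 : Matrix (Fin N) (Fin N) ℂ)) := by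
      rw [sub_sub_sub_cancel_left, ← sub_smul]
    calc rsv A z - rsv A w = rsv A z * ((A - w • (1 : Matrix (Fin N) (Fin N) ℂ)) - (A - z • (1 : Matrix (Fin N) (Fin N) ℂ))) * rsv A w := by
          rw [mul_sub, sub_mul, mul_rsv hA hz, mul_assoc, rsv_mul hA hw, mul_one, one_mul]
      _ = _ := by rw [← h3]; simp
  rw [stTrans_eq, stTrans_eq, ← sub_div, ← Matrix.trace_sub, h1, Matrix.trace_smul, norm_div,
    Complex.norm_natCast, smul_eq_mul, norm_mul]
  have hN' : (0:ℝ) < N := by exact_mod_cast hN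
  have h2 : ‖Matrix.trace (rsv A z * rsv A w)‖ ≤ N / (z.im * w.im) := by
    have e : ‖Matrix.trace (rsv A z * rsv A w)‖ ≤ ∑ p : Fin N × Fin N, ‖rsv A z p.1 p.2‖ * ‖rsv A w p.2 p.1‖ := by
      rw [Fintype.sum_prod_type]
      refine norm_sum_le_of_le _ fun j _ => ?_
      rw [Matrix.diag_apply, Matrix.mul_apply]
      refine norm_sum_le_of_le _ fun k _ => ?_
      rw [norm_mul]
    refine e.trans ?_
    refine (Real.sum_mul_le_sqrt_mul_sqrt _ _ _).trans ?_
    have a1 : ∑ p : Fin N × Fin N, ‖rsv A z p.1 p.2‖ ^ 2 ≤ N / z.im ^ 2 := by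
      rw [Fintype.sum_prod_type]; exact rsv_hs_le hA hz
    have a2 : ∑ p : Fin N × Fin N, ‖rsv A w p.2 p.1‖ ^ 2 ≤ N / w.im ^ 2 := by
      rw [Fintype.sum_prod_type_right]; exact rsv_hs_le hA hw
    calc _ ≤ √(N / z.im ^ 2) * √(N / w.im ^ 2) := by gcongr
      _ = _ := by
        rw [Real.sqrt_div (by positivity), Real.sqrt_div (by positivity), Real.sqrt_sq hz.le, Real.sqrt_sq hw.le,
          div_mul_div_comm, Real.mul_self_sqrt (by positivity)]
  rw [div_le_iff₀ hN']
  calc ‖z - w‖ * ‖Matrix.trace (rsv A z * rsv A w)‖ ≤ ‖z - w‖ * (N / (z.im * w.im)) := by gcongr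
    _ = _ := by ring

/-- zero out row and column `i` -/
def zrow {N : ℕ} (i : Fin N) (A : Matrix (Fin N) (Fin N) ℂ) : Matrix (Fin N) (Fin N) ℂ :=
  fun j k => if j = i ∨ k = i then 0 else A j k

/-- column `i` without the diagonal entry -/
def colv {N : ℕ} (i : Fin N) (A : Matrix (Fin N) (Fin N) ℂ) : Fin N → ℂ :=
  fun j => if j = i then 0 else A j i

/-- quadratic form -/
def qf {N : ℕ} (R : Matrix (Fin N) (Fin N) ℂ) (v : Fin N → ℂ) : ℂ :=
  star v ⬝ᵥ (R.mulVec v)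

lemma zrow_herm {N : ℕ} (i : Fin N) {A : Matrix (Fin N) (Fin N) ℂ} (hA : A.IsHermitian) :
    (zrow i A).IsHermitian := by
  ext j k
  simp only [Matrix.conjTranspose_apply, zrow]
  by_cases h : j = i ∨ k = i
  · rw [if_pos h, if_pos h.symm]; simp
  · rw [if_neg h, if_neg (fun h' => h h'.symm)]; exact hA.apply j k

lemma decomp {N : ℕ} (i : Fin N) {A : Matrix (Fin N) (Fin N) ℂ} (hA : A.IsHermitian) :
    A = zrow i A + Matrix.vecMulVec (Pi.single i 1) (star (colv i A))
      + Matrix.vecMulVec (colv i A) (Pi.single i 1)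
      + A i i • Matrix.vecMulVec (Pi.single i 1) (Pi.single i 1) := by
  ext j k
  simp only [Matrix.add_apply, Matrix.vecMulVec_apply, Matrix.smul_apply, zrow, colv, Pi.star_apply]
  by_cases hj : j = i
  · by_cases hk : k = i
    · simp [hj, hk]
    · subst hj
      have := hA.apply j k
      simp [hk]
      rw [← this]; rfl
  · by_cases hk : k = i
    · simp [hj, hk]
    · simp [hj, hk]

lemma qf_im {N : ℕ} {A : Matrix (Fin N) (Fin N) ℂ} (hA : A.IsHermitian) {z : ℂ}
    (hz : 0 < z.im) (v : Fin N → ℂ) :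
    ∑ j, ‖(rsv A z).mulVec v j‖ ^ 2 = (qf (rsv A z) v).im / z.im := by
  have h := rsv_ward' hA hz
  set R := rsv A z
  have h1 : star v ⬝ᵥ ((R - R.conjTranspose).mulVec v) = qf R v - starRingEnd ℂ (qf R v) := by
    rw [Matrix.sub_mulVec, dotProduct_sub]
    congr 1
    unfold qf
    have : starRingEnd ℂ (star v ⬝ᵥ R.mulVec v) = star (star v ⬝ᵥ R.mulVec v) := rfl
    rw [this, Matrix.star_dotProduct, Matrix.star_mulVec, Matrix.conjTranspose_conjTranspose, ← Matrix.dotProduct_mulVec]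
  have h2 : star v ⬝ᵥ ((R.conjTranspose * R).mulVec v) = ((∑ j, ‖R.mulVec v j‖ ^ 2 : ℝ) : ℂ) := by
    rw [← Matrix.mulVec_mulVec, Matrix.dotProduct_mulVec, ← Matrix.star_mulVec]
    simp only [dotProduct, Pi.star_apply, RCLike.star_def, Complex.conj_mul']
    push_cast; rfl
  rw [h, Matrix.smul_mulVec, dotProduct_smul, h2] at h1
  have h' := congrArg Complex.im h1
  rw [eq_div_iff hz.ne']
  generalize (∑ j, ‖R.mulVec v j‖ ^ 2 : ℝ) = T at h'
  simp at h'
  linarith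

lemma qf_im' {N : ℕ} {A : Matrix (Fin N) (Fin N) ℂ} (hA : A.IsHermitian) {z : ℂ}
    (hz : 0 < z.im) (v : Fin N → ℂ) :
    ∑ j, ‖Matrix.vecMul (star v) (rsv A z) j‖ ^ 2 = (qf (rsv A z) v).im / z.im := by
  have h := rsv_ward hA hz
  set R := rsv A z
  have h1 : star v ⬝ᵥ ((R - R.conjTranspose).mulVec v) = qf R v - starRingEnd ℂ (qf R v) := by
    rw [Matrix.sub_mulVec, dotProduct_sub]
    congr 1
    unfold qf
    have : starRingEnd ℂ (star v ⬝ᵥ R.mulVec v) = star (star v ⬝ᵥ R.mulVec v) := rfl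
    rw [this, Matrix.star_dotProduct, Matrix.star_mulVec, Matrix.conjTranspose_conjTranspose, ← Matrix.dotProduct_mulVec]
  have h2 : star v ⬝ᵥ ((R * R.conjTranspose).mulVec v) = ((∑ j, ‖Matrix.vecMul (star v) R j‖ ^ 2 : ℝ) : ℂ) := by
    rw [← Matrix.mulVec_mulVec, Matrix.dotProduct_mulVec]
    have : R.conjTranspose.mulVec v = star (Matrix.vecMul (star v) R) := by
      rw [Matrix.star_vecMul]; simp
    rw [this]
    simp only [dotProduct, Pi.star_apply, RCLike.star_def, Complex.mul_conj']
    push_cast; rfl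
  rw [h, Matrix.smul_mulVec, dotProduct_smul, h2] at h1
  have h' := congrArg Complex.im h1
  rw [eq_div_iff hz.ne']
  generalize (∑ j, ‖Matrix.vecMul (star v) R j‖ ^ 2 : ℝ) = T at h'
  simp at h'
  linarith

lemma qf_im_nonneg {N : ℕ} {A : Matrix (Fin N) (Fin N) ℂ} (hA : A.IsHermitian) {z : ℂ}
    (hz : 0 < z.im) (v : Fin N → ℂ) : 0 ≤ (qf (rsv A z) v).im := by
  have h := qf_im hA hz v
  have h2 : 0 ≤ (qf (rsv A z) v).im / z.im := h ▸ by positivity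
  by_contra hc
  push Not at hc
  exact absurd h2 (not_le.2 (div_neg_of_neg_of_pos hc hz))

lemma schur_full {N : ℕ} (i : Fin N) {A : Matrix (Fin N) (Fin N) ℂ} (hA : A.IsHermitian) {z : ℂ}
    (hz : 0 < z.im) :
    (rsv A z i i) * (A i i - z - qf (rsv (zrow i A) z) (colv i A)) = 1 ∧
    ‖Matrix.trace (rsv A z) - (Matrix.trace (rsv (zrow i A) z) + 1 / z)‖ ≤ 1 / z.im ∧
    rsv (zrow i A) z i i = -1 / z := by
  have hZ := zrow_herm i hA
  have hz0 : z ≠ 0 := by rintro rfl; simp at hz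
  set R := rsv (zrow i A) z with hR
  set v := colv i A with hv
  set e : Fin N → ℂ := Pi.single i 1 with he
  set q := qf R v with hq
  set Z := zrow i A with hZd
  have hqim : 0 ≤ q.im := qf_im_nonneg hZ hz v
  have hAii : (A i i).im = 0 := by
    have := hA.apply i i
    exact Complex.conj_eq_iff_im.1 this
  have hd : A i i - z - q ≠ 0 := by
    intro h
    have := congrArg Complex.im h
    simp [hAii] at this
    linarith
  set g := 1 / (A i i - z - q) with hg
  -- action on e
  have hRl := rsv_mul hZ hz
  have hRr := mul_rsv hZ hz
  rw [← hR] at hRl hRr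
  have hZe : (Z - z • (1 : Matrix (Fin N) (Fin N) ℂ)).mulVec e = -z • e := by
    ext j
    simp [he, hZd, zrow, Matrix.one_apply, Pi.single_apply]
    split_ifs <;> simp
  have heZ : Matrix.vecMul e (Z - z • (1 : Matrix (Fin N) (Fin N) ℂ)) = -z • e := by
    ext j
    simp [he, Matrix.vecMul_sub, Matrix.vecMul_smul, hZd, zrow]
  have hRe : R.mulVec e = (-1 / z) • e := by
    have := congrArg (R.mulVec) hZe
    rw [Matrix.mulVec_mulVec, hRr, Matrix.one_mulVec, Matrix.mulVec_smul] at this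
    nth_rewrite 2 [this]
    rw [smul_smul]
    field_simp
    simp
  have heR : Matrix.vecMul e R = (-1 / z) • e := by
    have := congrArg (fun x => Matrix.vecMul x R) heZ
    simp only [Matrix.vecMul_vecMul, hRl, Matrix.vecMul_one, Matrix.smul_vecMul] at this
    nth_rewrite 2 [this]
    rw [smul_smul]
    field_simp
    simp
  set u := R.mulVec v with hu
  set y := Matrix.vecMul (star v) R with hy
  have hvi : v i = 0 := by simp [hv, colv]
  have hui : e ⬝ᵥ u = 0 := by
    rw [hu, Matrix.dotProduct_mulVec, heR]; simp [he, hvi]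
  have hyi : y ⬝ᵥ e = 0 := by
    rw [hy, ← Matrix.dotProduct_mulVec, hRe]; simp [he, hvi]
  have hev : e ⬝ᵥ v = 0 := by simp [he, hvi]
  have hve : (star v) ⬝ᵥ e = 0 := by simp [he, hvi]
  have hee : e ⬝ᵥ e = 1 := by simp [he]
  have hAd : A - z • (1 : Matrix (Fin N) (Fin N) ℂ) = (Z - z • (1 : Matrix (Fin N) (Fin N) ℂ))
      + (Matrix.vecMulVec e (star v) + Matrix.vecMulVec v e + A i i • Matrix.vecMulVec e e) := by
    conv_lhs => rw [decomp i hA]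
    abel
  have hx : (A - z • (1 : Matrix (Fin N) (Fin N) ℂ)).mulVec (e - u) = (A i i - z - q) • e := by
    rw [hAd, Matrix.add_mulVec, Matrix.mulVec_sub, hZe, hu, Matrix.mulVec_mulVec, hRl, Matrix.one_mulVec,
      Matrix.add_mulVec, Matrix.add_mulVec, Matrix.smul_mulVec, Matrix.vecMulVec_mulVec, Matrix.vecMulVec_mulVec,
      Matrix.vecMulVec_mulVec, dotProduct_sub, dotProduct_sub, ← hu, hui, hve, hee]
    have : star v ⬝ᵥ u = q := rfl
    rw [this]
    ext j; simp; ring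
  have hB : rsv A z = R + (1 / z) • Matrix.vecMulVec e e + g • Matrix.vecMulVec (e - u) (e - y) := by
    apply rsv_eq_of_mul
    have t1 : (A - z • (1 : Matrix (Fin N) (Fin N) ℂ)) * R = 1 + Matrix.vecMulVec e y
        + (-1 / z) • Matrix.vecMulVec v e + (A i i * (-1 / z)) • Matrix.vecMulVec e e := by
      rw [hAd, add_mul, hRl, add_mul, add_mul, Matrix.smul_mul, Matrix.vecMulVec_mul, Matrix.vecMulVec_mul,
        Matrix.vecMulVec_mul, heR, ← hy, Matrix.vecMulVec_smul, Matrix.vecMulVec_smul, smul_smul]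
      abel
    have t2 : (A - z • (1 : Matrix (Fin N) (Fin N) ℂ)).mulVec e = v + (A i i - z) • e := by
      rw [hAd, Matrix.add_mulVec, hZe, Matrix.add_mulVec, Matrix.add_mulVec, Matrix.smul_mulVec,
        Matrix.vecMulVec_mulVec, Matrix.vecMulVec_mulVec, Matrix.vecMulVec_mulVec, hve, hee]
      ext j; simp; ring
    rw [mul_add, mul_add, Matrix.mul_smul, Matrix.mul_smul, Matrix.mul_vecMulVec, Matrix.mul_vecMulVec, t1, t2, hx]
    ext j k
    simp only [Matrix.add_apply, Matrix.vecMulVec_apply, Matrix.smul_apply, Pi.add_apply, Pi.smul_apply, Pi.sub_apply, smul_eq_mul]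
    rw [hg]
    field_simp
    ring
  have h1 : R i i = -1 / z := by
    have := congrFun hRe i
    simpa [he] using this
  refine ⟨?_, ?_, h1⟩
  · rw [hB]
    have h2 : u i = 0 := by simpa [he] using hui
    have h3 : y i = 0 := by simpa [he] using hyi
    simp only [Matrix.add_apply, Matrix.vecMulVec_apply, Matrix.smul_apply, Pi.sub_apply, smul_eq_mul, h1, h2, h3]
    simp only [he, Pi.single_eq_same, hg]
    field_simp
    try ring
  · have htr : Matrix.trace (rsv A z) - (Matrix.trace R + 1 / z) = g * (1 + u ⬝ᵥ y) := by
      rw [hB, Matrix.trace_add, Matrix.trace_add, Matrix.trace_smul, Matrix.trace_smul, Matrix.trace_vecMulVec,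
        Matrix.trace_vecMulVec, hee, dotProduct_sub, sub_dotProduct, sub_dotProduct, hee, dotProduct_comm u e, hui,
        dotProduct_comm e y, hyi]
      simp
    rw [htr, norm_mul]
    have h1 : ‖u ⬝ᵥ y‖ ≤ q.im / z.im := by
      have a1 := qf_im hZ hz v
      have a2 := qf_im' hZ hz v
      calc ‖u ⬝ᵥ y‖ ≤ ∑ j, ‖u j‖ * ‖y j‖ := norm_sum_le_of_le _ fun j _ => by rw [norm_mul]
        _ ≤ √(∑ j, ‖u j‖ ^ 2) * √(∑ j, ‖y j‖ ^ 2) := Real.sum_mul_le_sqrt_mul_sqrt _ _ _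
        _ = _ := by rw [hu, hy, a1, a2, Real.mul_self_sqrt]; positivity
    have h2 : ‖1 + u ⬝ᵥ y‖ ≤ (z.im + q.im) / z.im := by
      calc _ ≤ 1 + ‖u ⬝ᵥ y‖ := (norm_add_le _ _).trans (by simp)
        _ ≤ 1 + q.im / z.im := by gcongr
        _ = _ := by field_simp
    have h3 : z.im + q.im ≤ ‖A i i - z - q‖ := by
      have := Complex.abs_im_le_norm (A i i - z - q)
      simp [hAii] at this
      rw [abs_le] at this
      linarith [this.1]
    have h4 : 0 < ‖A i i - z - q‖ := norm_pos_iff.2 hd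
    rw [hg, norm_div, norm_one]
    calc 1 / ‖A i i - z - q‖ * ‖1 + u ⬝ᵥ y‖ ≤ 1 / ‖A i i - z - q‖ * (‖A i i - z - q‖ / z.im) := by
          gcongr; exact h2.trans (by gcongr)
      _ = _ := by field_simp

lemma sub_ne_of_im {z : ℂ} (hz : 0 < z.im) (x : ℝ) : (x : ℂ) - z ≠ 0 := by
  intro h
  have := congrArg Complex.im h
  simp at this
  linarith

lemma mSC_interval (z : ℂ) :
    mSC z = ∫ x in (-2 : ℝ)..2, ((Real.sqrt (4 - x ^ 2) / (2 * Real.pi) : ℝ) : ℂ) / ((x : ℂ) - z) := by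
  rw [intervalIntegral.integral_of_le (by norm_num), ← integral_Icc_eq_integral_Ioc, mSC,
    ← integral_indicator measurableSet_Icc]
  congr 1
  ext x
  by_cases h : x ∈ Set.Icc (-2 : ℝ) 2
  · rw [Set.indicator_of_mem h, rhoSC, if_pos (abs_le.2 h)]
  · rw [Set.indicator_of_notMem h, rhoSC, if_neg (fun h' => h (abs_le.1 h'))]; simp

lemma mSC_theta {z : ℂ} (hz : 0 < z.im) :
    mSC z = (1 / (2 * Real.pi) : ℂ) * ∫ θ in (0 : ℝ)..Real.pi,
      (4 - (2 * Real.cos θ) ^ 2 : ℂ) / (2 * Real.cos θ - z) := by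
  rw [mSC_interval z]
  have hc : Continuous fun x : ℝ => ((Real.sqrt (4 - x ^ 2) / (2 * Real.pi) : ℝ) : ℂ) / ((x : ℂ) - z) := by
    apply Continuous.div
    · apply Complex.continuous_ofReal.comp
      fun_prop
    · fun_prop
    · exact sub_ne_of_im hz
  have h := intervalIntegral.integral_deriv_smul_comp (a := 0) (b := Real.pi) (f := fun θ : ℝ => 2 * Real.cos θ)
    (f' := fun θ => 2 * (-Real.sin θ))
    (g := fun x : ℝ => ((Real.sqrt (4 - x ^ 2) / (2 * Real.pi) : ℝ) : ℂ) / ((x : ℂ) - z))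
    (fun x _ => (Real.hasDerivAt_cos x).const_mul 2) (by fun_prop) hc
  simp only [Real.cos_zero, Real.cos_pi, mul_one, mul_neg] at h
  rw [intervalIntegral.integral_symm, ← h, ← intervalIntegral.integral_const_mul, ← intervalIntegral.integral_neg]
  apply intervalIntegral.integral_congr
  intro θ hθ
  rw [Set.uIcc_of_le Real.pi_pos.le] at hθ
  have hs : 0 ≤ Real.sin θ := Real.sin_nonneg_of_mem_Icc hθ
  have hsq : Real.sqrt (4 - (2 * Real.cos θ) ^ 2) = 2 * Real.sin θ := by
    rw [Real.sqrt_eq_iff_mul_self_eq (by nlinarith [Real.sin_sq_add_cos_sq θ]) (by positivity)]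
    nlinarith [Real.sin_sq_add_cos_sq θ]
  have hsq' : (4 - (2 * Real.cos θ) ^ 2 : ℂ) = (2 * Real.sin θ) ^ 2 := by
    have : (4 - (2 * Real.cos θ) ^ 2) = (2 * Real.sin θ) ^ 2 := by nlinarith [Real.sin_sq_add_cos_sq θ]
    exact_mod_cast congrArg (fun x : ℝ => (x : ℂ)) this
  simp only [Function.comp, hsq, hsq', Complex.real_smul]
  have := sub_ne_of_im hz (2 * Real.cos θ)
  have hpi : (Real.pi : ℂ) ≠ 0 := by exact_mod_cast Real.pi_ne_zero
  push_cast at this ⊢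
  field_simp
  try ring

lemma exists_root {z : ℂ} (hz : 0 < z.im) : ∃ s : ℂ, s ^ 2 + z * s + 1 = 0 ∧ ‖s‖ < 1 ∧ s ≠ 0 := by
  obtain ⟨w, hw⟩ : ∃ w : ℂ, w ^ 2 = z ^ 2 - 4 := by
    obtain ⟨w, hw⟩ := IsAlgClosed.exists_pow_nat_eq (z ^ 2 - 4) (n := 2) (by norm_num)
    exact ⟨w, hw⟩
  set a := (-z + w) / 2 with ha
  have ha0 : a ^ 2 + z * a + 1 = 0 := by rw [ha]; linear_combination hw / 4
  have hne : a ≠ 0 := by rintro h; rw [h] at ha0; simp at ha0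
  have hza : z = -(a + 1 / a) := by field_simp; linear_combination ha0
  rcases lt_trichotomy ‖a‖ 1 with h | h | h
  · exact ⟨a, ha0, h, hne⟩
  · exfalso
    have : 1 / a = starRingEnd ℂ a := by
      rw [one_div, Complex.inv_def, Complex.normSq_eq_norm_sq, h]; simp
    rw [this] at hza
    rw [hza] at hz
    simp at hz
  · refine ⟨1 / a, ?_, ?_, by simpa using hne⟩
    · field_simp; linear_combination ha0
    · rw [norm_div, norm_one, div_lt_one (by linarith)]; exact h

lemma int_theta {z s : ℂ} (hz : 0 < z.im) (hs : s ^ 2 + z * s + 1 = 0) (hs1 : ‖s‖ < 1) (hs0 : s ≠ 0) :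
    ∫ θ in (0 : ℝ)..Real.pi, 1 / (2 * Real.cos θ - z : ℂ) = Real.pi * s / (1 - s ^ 2) := by
  have hnz : ∀ ζ : ℂ, ‖ζ‖ ≤ 1 → 1 + s * ζ ≠ 0 := by
    intro ζ hζ h
    have : ‖s * ζ‖ = 1 := by
      rw [show s * ζ = -1 by linear_combination h]; simp
    rw [norm_mul] at this
    nlinarith [norm_nonneg s, norm_nonneg ζ]
  set f : ℂ → ℂ := fun ζ => 1 / (1 + s * ζ) with hf
  have h1s : 1 - s ^ 2 ≠ 0 := by
    have := hnz (-s) (by simpa using hs1.le)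
    intro h; apply this; linear_combination h
  have hav : Real.circleAverage f 0 1 = f 0 := by
    apply DiffContOnCl.circleAverage
    rw [abs_one]
    apply DifferentiableOn.diffContOnCl
    intro ζ hζ
    rw [closure_ball _ one_ne_zero] at hζ
    have := hnz ζ (by simpa using hζ)
    apply DifferentiableAt.differentiableWithinAt
    apply DifferentiableAt.div
    · fun_prop
    · fun_prop
    · exact this
  have hcirc : ∀ θ : ℝ, circleMap 0 1 θ = Complex.exp (θ * Complex.I) := by intro θ; simp [circleMap]
  have hfc : Continuous fun θ : ℝ => f (Complex.exp (θ * Complex.I)) := by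
    rw [hf]
    apply Continuous.div
    · fun_prop
    · fun_prop
    · intro θ; apply hnz; rw [Complex.norm_exp_ofReal_mul_I]
  have hint : ∫ θ in (0 : ℝ)..(2 * Real.pi), f (Complex.exp (θ * Complex.I)) = 2 * Real.pi := by
    have h2 := hav
    rw [Real.circleAverage_def] at h2
    simp only [hcirc] at h2
    have hp : (Real.pi : ℂ) ≠ 0 := by exact_mod_cast Real.pi_ne_zero
    rw [Complex.real_smul] at h2
    simp [hf] at h2 ⊢
    field_simp at h2
    simpa [mul_comm] using h2
  have hint2 : ∫ θ in (-Real.pi : ℝ)..Real.pi, f (Complex.exp (θ * Complex.I)) = 2 * Real.pi := by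
    rw [← hint]
    have hper : Function.Periodic (fun θ : ℝ => f (Complex.exp (θ * Complex.I))) (2 * Real.pi) := by
      intro θ
      simp only
      congr 1
      have := Complex.exp_periodic (θ * Complex.I)
      rw [← this]; congr 1; push_cast; ring
    have := hper.intervalIntegral_add_eq (-Real.pi) 0
    rw [show -Real.pi + 2 * Real.pi = Real.pi by ring, zero_add] at this
    exact this
  have hint3 : ∫ θ in (0 : ℝ)..Real.pi, (f (Complex.exp (θ * Complex.I)) + f (Complex.exp ((-θ : ℝ) * Complex.I)))
      = 2 * Real.pi := by
    have hfn : Continuous fun θ : ℝ => f (Complex.exp ((-θ : ℝ) * Complex.I)) := hfc.comp continuous_neg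
    rw [intervalIntegral.integral_add (hfc.intervalIntegrable _ _) (hfn.intervalIntegrable _ _)]
    have := intervalIntegral.integral_comp_neg (a := 0) (b := Real.pi) (fun θ : ℝ => f (Complex.exp (θ * Complex.I)))
    rw [this, ← hint2, neg_zero, add_comm]
    exact intervalIntegral.integral_add_adjacent_intervals (hfc.intervalIntegrable _ _) (hfc.intervalIntegrable _ _)
  have key : ∀ θ : ℝ, 1 / (2 * Real.cos θ - z : ℂ) = (s / (1 - s ^ 2)) *
      ((f (Complex.exp (θ * Complex.I)) + f (Complex.exp ((-θ : ℝ) * Complex.I))) - 1) := by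
    intro θ
    set ζ := Complex.exp (θ * Complex.I) with hζ
    set ζ' := Complex.exp ((-θ : ℝ) * Complex.I) with hζ'
    have hzz : ζ * ζ' = 1 := by rw [hζ, hζ', ← Complex.exp_add]; simp
    have hcos : (2 * Real.cos θ : ℂ) = ζ + ζ' := by
      rw [Complex.ofReal_cos, Complex.two_cos, hζ, hζ']; simp
    have e1 := hnz ζ (by rw [hζ, Complex.norm_exp_ofReal_mul_I])
    have e2 := hnz ζ' (by rw [hζ', Complex.norm_exp_ofReal_mul_I])
    have e3 : s * (ζ + ζ' - z) = (1 + s * ζ) * (1 + s * ζ') := by linear_combination (-hs) - s ^ 2 * hzz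
    have e4 : ζ + ζ' - z ≠ 0 := by
      intro h; rw [h, mul_zero] at e3; exact (mul_ne_zero e1 e2) e3.symm
    rw [hcos, hf]
    rw [div_eq_iff e4]
    have : (s / (1 - s ^ 2) * (1 / (1 + s * ζ) + 1 / (1 + s * ζ') - 1)) * (ζ + ζ' - z) =
      (s * (ζ + ζ' - z)) * ((1 / (1 + s * ζ) + 1 / (1 + s * ζ') - 1) / (1 - s ^ 2)) := by ring
    simp only
    rw [this, e3]
    field_simp
    linear_combination (s ^ 2) * hzz
  rw [intervalIntegral.integral_congr (fun θ _ => key θ), intervalIntegral.integral_const_mul,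
    intervalIntegral.integral_sub, hint3]
  · simp; field_simp; ring
  · exact ((hfc.add (hfc.comp continuous_neg))).intervalIntegrable _ _
  · exact intervalIntegrable_const

lemma mSC_eq_root {z s : ℂ} (hz : 0 < z.im) (hs : s ^ 2 + z * s + 1 = 0) (hs1 : ‖s‖ < 1) (hs0 : s ≠ 0) :
    mSC z = s := by
  rw [mSC_theta hz]
  have hne : ∀ θ : ℝ, (2 * Real.cos θ - z : ℂ) ≠ 0 := by
    intro θ; have := sub_ne_of_im hz (2 * Real.cos θ); push_cast at this ⊢; exact this
  have h1s : 1 - s ^ 2 ≠ 0 := by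
    intro h
    have : ‖s ^ 2‖ = 1 := by rw [show s ^ 2 = 1 by linear_combination -h]; simp
    rw [norm_pow] at this
    nlinarith [norm_nonneg s]
  have key : ∀ θ : ℝ, (4 - (2 * Real.cos θ) ^ 2 : ℂ) / (2 * Real.cos θ - z) =
      (-(2 * Real.cos θ : ℝ) - z) + (4 - z ^ 2) * (1 / (2 * Real.cos θ - z : ℂ)) := by
    intro θ
    have := hne θ
    field_simp
    push_cast
    ring
  have hcc : Continuous fun θ : ℝ => (1 / (2 * Real.cos θ - z : ℂ)) := by
    apply Continuous.div
    · fun_prop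
    · fun_prop
    · exact hne
  rw [intervalIntegral.integral_congr (fun θ _ => key θ), intervalIntegral.integral_add,
    intervalIntegral.integral_const_mul, int_theta hz hs hs1 hs0, intervalIntegral.integral_sub,
    intervalIntegral.integral_neg, intervalIntegral.integral_ofReal, intervalIntegral.integral_const_mul,
    integral_cos]
  · have hzs : z = -(s + 1 / s) := by field_simp; linear_combination hs
    have hp : (Real.pi : ℂ) ≠ 0 := by exact_mod_cast Real.pi_ne_zero
    simp
    rw [hzs]
    field_simp
    ring
  · apply Continuous.intervalIntegrable; fun_prop
  · exact intervalIntegrable_const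
  · apply Continuous.intervalIntegrable; fun_prop
  · exact (continuous_const.mul hcc).intervalIntegrable _ _

/-- basic facts -/
lemma mSC_facts {z : ℂ} (hz : 0 < z.im) :
    (mSC z) ^ 2 + z * mSC z + 1 = 0 ∧ ‖mSC z‖ < 1 ∧ mSC z ≠ 0 ∧ 0 < (mSC z).im := by
  obtain ⟨s, h1, h2, h3⟩ := exists_root hz
  rw [mSC_eq_root hz h1 h2 h3]
  refine ⟨h1, h2, h3, ?_⟩
  have hzs : z = -(s + 1 / s) := by field_simp; linear_combination h1
  have h4 : z.im = -s.im + s.im / ‖s‖ ^ 2 := by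
    rw [hzs, one_div]
    simp [Complex.inv_im, Complex.normSq_eq_norm_sq]
    ring
  have h5 : 0 < ‖s‖ := norm_pos_iff.2 h3
  by_contra hc
  push Not at hc
  have : s.im / ‖s‖ ^ 2 ≤ s.im := by
    rw [div_le_iff₀ (by positivity)]
    have hr : ‖s‖ ^ 2 ≤ 1 := by nlinarith
    nlinarith [mul_nonneg (neg_nonneg.2 hc) (sub_nonneg.2 hr)]
  linarith

lemma mSC_norm_le {z : ℂ} (hz : 0 < z.im) : ‖mSC z‖ ≤ 1 / z.im := by
  obtain ⟨h1, h2, h3, h4⟩ := mSC_facts hz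
  have : mSC z * (-(z + mSC z)) = 1 := by linear_combination -h1
  have h5 := congrArg norm this
  rw [norm_mul, norm_neg, norm_one] at h5
  have h6 : z.im ≤ ‖z + mSC z‖ := by
    have := Complex.abs_im_le_norm (z + mSC z)
    rw [Complex.add_im, abs_of_pos (by linarith)] at this
    linarith
  rw [le_div_iff₀ hz, ← h5]
  gcongr

/-- lower bound on the imaginary part in the bulk -/
lemma mSC_im_lower {κ : ℝ} (hκ : 0 < κ) (hκ2 : κ ≤ 2) : ∃ c : ℝ, 0 < c ∧ ∀ E η : ℝ, |E| ≤ 2 - κ → 0 < η → η ≤ 16 →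
    c ≤ (mSC ((E : ℂ) + η * Complex.I)).im := by
  have hk : 0 < √(κ / 2) := Real.sqrt_pos.2 (by linarith)
  refine ⟨√(κ / 2) / 20, by positivity, ?_⟩
  intro E η hE h0 h16
  set z := (E : ℂ) + η * Complex.I with hzd
  have hzi : z.im = η := by simp [hzd]
  have hzr : z.re = E := by simp [hzd]
  have hz : 0 < z.im := by rw [hzi]; exact h0
  obtain ⟨h1, h2, h3, h4⟩ := mSC_facts hz
  set s := mSC z with hs
  have hzs : z = -(s + 1 / s) := by field_simp; linear_combination h1
  have hr0 : 0 < ‖s‖ := norm_pos_iff.2 h3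
  have hre : E = -(s.re + s.re / ‖s‖ ^ 2) := by
    rw [← hzr, hzs, one_div]; simp [Complex.inv_re, Complex.normSq_eq_norm_sq]
  have hlow : 1 / 20 ≤ ‖s‖ := by
    have : ‖z‖ ≤ 18 := by
      calc ‖z‖ ≤ |z.re| + |z.im| := Complex.norm_le_abs_re_add_abs_im z
        _ ≤ 18 := by rw [hzr, hzi, abs_of_pos h0]; linarith
    have h5 : (1 : ℝ) = ‖s‖ * ‖z + s‖ := by
      rw [← norm_mul, show s * (z + s) = -1 by linear_combination h1]; simp
    have h6 : ‖z + s‖ ≤ 20 := (norm_add_le _ _).trans (by linarith)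
    nlinarith
  have hsq : ‖s‖ ^ 2 = s.re ^ 2 + s.im ^ 2 := by
    rw [← Complex.normSq_eq_norm_sq, Complex.normSq_apply]; ring
  -- |E| ‖s‖ ≥ 2 |re s|
  have h7 : |E| * ‖s‖ ^ 2 = |s.re| * (‖s‖ ^ 2 + 1) := by
    have : E * ‖s‖ ^ 2 = -(s.re * (‖s‖ ^ 2 + 1)) := by rw [hre]; field_simp
    have h8 := congrArg abs this
    rw [abs_mul, abs_neg, abs_mul, abs_of_pos (by positivity : 0 < ‖s‖ ^ 2), abs_of_pos (by positivity : 0 < ‖s‖ ^ 2 + 1)] at h8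
    exact h8
  have h8 : 2 * |s.re| ≤ |E| * ‖s‖ := by
    have : ‖s‖ * (2 * |s.re|) ≤ ‖s‖ * (|E| * ‖s‖) := by nlinarith [abs_nonneg s.re, sq_nonneg (‖s‖ - 1)]
    exact le_of_mul_le_mul_left this hr0
  have h9 : |s.re| ≤ (1 - κ / 2) * ‖s‖ := by nlinarith
  have h10 : s.re ^ 2 ≤ ((1 - κ / 2) * ‖s‖) ^ 2 := by
    rw [← sq_abs]; gcongr
  have h11 : (κ / 2) * ‖s‖ ^ 2 ≤ s.im ^ 2 := by
    have : (1 - κ / 2) ^ 2 ≤ 1 - κ / 2 := by nlinarith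
    nlinarith [mul_le_mul_of_nonneg_right this (sq_nonneg ‖s‖)]
  have h12 : √(κ / 2) * ‖s‖ ≤ s.im := by
    rw [← pow_le_pow_iff_left₀ (by positivity) h4.le two_ne_zero]
    rw [mul_pow, Real.sq_sqrt (by linarith)]; exact h11
  calc √(κ / 2) / 20 = √(κ / 2) * (1 / 20) := by ring
    _ ≤ √(κ / 2) * ‖s‖ := by gcongr
    _ ≤ _ := h12

lemma mSC_gap {z : ℂ} {h : ℝ} (hh : 0 < h) (hz : h ≤ z.im) : h * ‖mSC z‖ ≤ 1 - ‖mSC z‖ ^ 2 := by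
  obtain ⟨h1, h2, h3, h4⟩ := mSC_facts (hh.trans_le hz)
  set s := mSC z
  have hr0 : 0 < ‖s‖ := norm_pos_iff.2 h3
  have hzs : z = -(s + 1 / s) := by field_simp; linear_combination h1
  have h5 : z.im = -s.im + s.im / ‖s‖ ^ 2 := by
    conv_lhs => rw [hzs, one_div]
    simp [Complex.inv_im, Complex.normSq_eq_norm_sq]
    ring
  have h6 : z.im * ‖s‖ ^ 2 = s.im * (1 - ‖s‖ ^ 2) := by rw [h5]; field_simp; ring
  have h7 : s.im ≤ ‖s‖ := (le_abs_self _).trans (Complex.abs_im_le_norm s)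
  have h8 : 0 ≤ 1 - ‖s‖ ^ 2 := by nlinarith
  have h9 : ‖s‖ * (h * ‖s‖) ≤ ‖s‖ * (1 - ‖s‖ ^ 2) := by
    calc ‖s‖ * (h * ‖s‖) = h * ‖s‖ ^ 2 := by ring
      _ ≤ z.im * ‖s‖ ^ 2 := by gcongr
      _ = s.im * (1 - ‖s‖ ^ 2) := h6
      _ ≤ _ := by gcongr
  exact le_of_mul_le_mul_left h9 hr0

lemma mSC_lip {z w : ℂ} {h : ℝ} (hh : 0 < h) (hz : h ≤ z.im) (hw : h ≤ w.im) :
    ‖mSC z - mSC w‖ ≤ ‖z - w‖ / h := by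
  have g1 := mSC_gap hh hz
  have g2 := mSC_gap hh hw
  obtain ⟨a1, a2, a3, a4⟩ := mSC_facts (hh.trans_le hz)
  obtain ⟨b1, b2, b3, b4⟩ := mSC_facts (hh.trans_le hw)
  set s := mSC z
  set t := mSC w
  have e : (s - t) * (1 - s * t) = s * t * (z - w) := by linear_combination s * b1 - t * a1
  have e' := congrArg norm e
  rw [norm_mul, norm_mul, norm_mul] at e'
  have hs := norm_nonneg s
  have ht := norm_nonneg t
  have hst : 0 < ‖s‖ * ‖t‖ := mul_pos (norm_pos_iff.2 a3) (norm_pos_iff.2 b3)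
  have h1 : h * (‖s‖ * ‖t‖) ≤ ‖1 - s * t‖ := by
    have h2 : 1 - ‖s‖ * ‖t‖ ≤ ‖1 - s * t‖ := by
      have := norm_sub_norm_le (1 : ℂ) (s * t)
      rwa [norm_one, norm_mul] at this
    have h3 : h * (‖s‖ * ‖t‖) ≤ h * ((‖s‖ + ‖t‖) / 2) := by
      gcongr; nlinarith
    nlinarith [sq_nonneg (‖s‖ - ‖t‖)]
  rw [le_div_iff₀ hh]
  have h2 : (‖s - t‖ * h) * (‖s‖ * ‖t‖) ≤ ‖z - w‖ * (‖s‖ * ‖t‖) := by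
    calc _ = ‖s - t‖ * (h * (‖s‖ * ‖t‖)) := by ring
      _ ≤ ‖s - t‖ * ‖1 - s * t‖ := by gcongr
      _ = _ := by rw [e']; ring
  exact le_of_mul_le_mul_right h2 hst

/-- stability of the self-consistent equation -/
lemma stab {z m : ℂ} (hz : 0 < z.im) (hm : 0 ≤ m.im) :
    (mSC z).im * ‖m - mSC z‖ ≤ ‖1 + z * m + m ^ 2‖ := by
  obtain ⟨a1, a2, a3, a4⟩ := mSC_facts hz
  set s := mSC z
  have e : 1 + z * m + m ^ 2 = (m + z + s) * (m - s) := by linear_combination a1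
  rw [e, norm_mul]
  gcongr
  have := Complex.abs_im_le_norm (m + z + s)
  rw [Complex.add_im, Complex.add_im, abs_of_pos (by linarith)] at this
  linarith

/-- shorthand for the exponential as an extended nonnegative real -/
def ee (x : ℝ) : ℝ≥0∞ := ENNReal.ofReal (Real.exp x)

lemma measurable_ee : Measurable ee := (Real.continuous_exp.measurable).ennreal_ofReal

lemma ee_mono {x y : ℝ} (h : x ≤ y) : ee x ≤ ee y :=
  ENNReal.ofReal_le_ofReal (Real.exp_le_exp.2 h)

lemma ee_add (x y : ℝ) : ee (x + y) = ee x * ee y := by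
  rw [ee, Real.exp_add, ENNReal.ofReal_mul (Real.exp_pos x).le]; rfl

lemma ee_sum {ι : Type*} (s : Finset ι) (f : ι → ℝ) : ee (∑ j ∈ s, f j) = ∏ j ∈ s, ee (f j) := by
  rw [ee, Real.exp_sum, ENNReal.ofReal_prod_of_nonneg (fun _ _ => (Real.exp_pos _).le)]; rfl

lemma exp_half (x y : ℝ) : Real.exp ((x + y) / 2) ≤ (Real.exp x + Real.exp y) / 2 := by
  have h1 : Real.exp ((x + y) / 2) = Real.exp (x / 2) * Real.exp (y / 2) := by rw [← Real.exp_add]; ring_nf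
  have h2 : Real.exp x = Real.exp (x / 2) ^ 2 := by rw [sq, ← Real.exp_add]; ring_nf
  have h3 : Real.exp y = Real.exp (y / 2) ^ 2 := by rw [sq, ← Real.exp_add]; ring_nf
  rw [h1, h2, h3]
  nlinarith [sq_nonneg (Real.exp (x / 2) - Real.exp (y / 2))]

lemma ee_half (x y : ℝ) : ee ((x + y) / 2) ≤ ee x + ee y := by
  rw [ee, ee, ee, ← ENNReal.ofReal_add (Real.exp_pos _).le (Real.exp_pos _).le]
  apply ENNReal.ofReal_le_ofReal
  linarith [exp_half x y, Real.exp_pos x, Real.exp_pos y]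

lemma ee_abs (x : ℝ) : ee |x| ≤ ee x + ee (-x) := by
  rcases abs_cases x with h | h
  · rw [h.1]; exact le_self_add
  · rw [h.1]; exact le_add_self

/-- weighted Jensen with subprobability weights -/
lemma exp_jensen {ι : Type*} (s : Finset ι) (w y : ι → ℝ) (hw : ∀ j ∈ s, 0 ≤ w j) (hW : ∑ j ∈ s, w j ≤ 1) :
    Real.exp (∑ j ∈ s, w j * y j) ≤ (1 - ∑ j ∈ s, w j) + ∑ j ∈ s, w j * Real.exp (y j) := by
  set a := ∑ j ∈ s, w j * y j with ha
  set W := ∑ j ∈ s, w j with hWd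
  have tang : ∀ t : ℝ, Real.exp a * (1 + t - a) ≤ Real.exp t := by
    intro t
    have : Real.exp t = Real.exp a * Real.exp (t - a) := by rw [← Real.exp_add]; ring_nf
    rw [this]
    gcongr
    linarith [Real.add_one_le_exp (t - a)]
  have h1 : ∑ j ∈ s, w j * (Real.exp a * (1 + y j - a)) ≤ ∑ j ∈ s, w j * Real.exp (y j) :=
    Finset.sum_le_sum fun j hj => mul_le_mul_of_nonneg_left (tang _) (hw j hj)
  have h2 : ∑ j ∈ s, w j * (Real.exp a * (1 + y j - a)) = Real.exp a * (W + a - W * a) := by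
    rw [hWd, ha, mul_sub, mul_add, Finset.sum_mul, Finset.mul_sum, Finset.mul_sum, Finset.mul_sum,
      ← Finset.sum_add_distrib, ← Finset.sum_sub_distrib]
    refine Finset.sum_congr rfl fun j _ => ?_
    rw [← ha]; ring
  have h3 := tang 0
  rw [Real.exp_zero] at h3
  have h4 : (1 - W) * (Real.exp a * (1 + 0 - a)) ≤ (1 - W) * 1 :=
    mul_le_mul_of_nonneg_left h3 (by linarith)
  nlinarith

lemma exp_quad (y : ℝ) : Real.exp y ≤ 1 + y + y ^ 2 * Real.exp |y| := by
  rcases le_total 0 y with h | h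
  · rw [abs_of_nonneg h]
    have h1 : Real.exp y - 1 ≤ y * Real.exp y := by
      have h2 := Real.add_one_le_exp (-y)
      have h3 : Real.exp (-y) * Real.exp y = 1 := by rw [← Real.exp_add]; simp
      nlinarith [Real.exp_pos y]
    nlinarith
  · rw [abs_of_nonpos h]
    have h1 : Real.exp y ≤ 1 + y + y ^ 2 := by
      have h2 := Real.add_one_le_exp (-y)
      have h3 : Real.exp (-y) * Real.exp y = 1 := by rw [← Real.exp_add]; simp
      have h5 : (1 - y) * Real.exp y ≤ 1 := by nlinarith [Real.exp_pos y]
      have h6 : (1 - y) * (1 + y + y ^ 2) ≥ 1 := by nlinarith [pow_nonneg (neg_nonneg.2 h) 3]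
      have h7 : (1 - y) * Real.exp y ≤ (1 - y) * (1 + y + y ^ 2) := h5.trans h6
      exact le_of_mul_le_mul_left h7 (by linarith)
    have h4 : 1 ≤ Real.exp (-y) := Real.one_le_exp (by linarith)
    nlinarith [sq_nonneg y]

lemma exp_le_id_add_sq (y : ℝ) : Real.exp y ≤ y + Real.exp (y ^ 2) := by
  rcases le_or_gt |y| 1 with h | h
  · have h1 := Real.abs_exp_sub_one_sub_id_le h
    have h2 := (abs_le.1 h1).2
    linarith [Real.add_one_le_exp (y ^ 2)]
  · rcases lt_abs.1 h with h | h
    · have : Real.exp y ≤ Real.exp (y ^ 2) := Real.exp_le_exp.2 (by nlinarith)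
      linarith
    · have h1 : Real.exp y ≤ 1 := Real.exp_le_one_iff.2 (by linarith)
      nlinarith [Real.add_one_le_exp (y ^ 2)]

/-- resampling: split a product measure into two independent blocks -/
lemma resample {ι : Type*} [Fintype ι] (μ : ι → Measure ℂ) [∀ i, IsProbabilityMeasure (μ i)]
    (p : ι → Prop) [DecidablePred p] {F : (ι → ℂ) → ℝ≥0∞} (hF : Measurable F) :
    ∫⁻ u, F u ∂(Measure.pi μ) =
      ∫⁻ u', ∫⁻ u, F (fun i => if p i then u i else u' i) ∂(Measure.pi μ) ∂(Measure.pi μ) := by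
  have hm : Measurable (fun x : (ι → ℂ) × (ι → ℂ) => (fun i => if p i then x.1 i else x.2 i : ι → ℂ)) := by
    apply measurable_pi_lambda
    intro i
    by_cases h : p i
    · simp only [h, if_true]; fun_prop
    · simp only [h, if_false]; fun_prop
  have hmap : Measure.map (fun x : (ι → ℂ) × (ι → ℂ) => (fun i => if p i then x.1 i else x.2 i : ι → ℂ))
      ((Measure.pi μ).prod (Measure.pi μ)) = Measure.pi μ := by
    symm
    apply Measure.pi_eq
    intro s hs
    rw [Measure.map_apply hm (MeasurableSet.univ_pi hs)]
    have : (fun x : (ι → ℂ) × (ι → ℂ) => (fun i => if p i then x.1 i else x.2 i : ι → ℂ)) ⁻¹' (Set.univ.pi s)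
      = (Set.univ.pi fun i => if p i then s i else Set.univ) ×ˢ (Set.univ.pi fun i => if p i then Set.univ else s i) := by
      ext x
      simp only [Set.mem_preimage, Set.mem_pi, Set.mem_univ, true_imp_iff, Set.mem_prod]
      constructor
      · intro h
        constructor
        · intro i; have := h i; by_cases hp : p i <;> simp_all
        · intro i; have := h i; by_cases hp : p i <;> simp_all
      · rintro ⟨h1, h2⟩ i
        have := h1 i; have := h2 i
        by_cases hp : p i <;> simp_all
    rw [this, Measure.prod_prod, Measure.pi_pi, Measure.pi_pi, ← Finset.prod_mul_distrib]
    refine Finset.prod_congr rfl fun i _ => ?_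
    by_cases hp : p i <;> simp [hp]
  conv_lhs => rw [← hmap]
  rw [lintegral_map hF hm]
  exact lintegral_prod_symm' _ (hF.comp hm)

lemma lintegral_pi_prod {ι : Type*} [Fintype ι] (μ : ι → Measure ℂ) [∀ i, IsProbabilityMeasure (μ i)]
    (f : ι → ℂ → ℝ≥0∞) (hf : ∀ i, Measurable (f i)) :
    ∫⁻ u, ∏ i, f i (u i) ∂(Measure.pi μ) = ∏ i, ∫⁻ x, f i x ∂(μ i) := by
  have hi : iIndepFun (fun i (u : ι → ℂ) => f i (u i)) (Measure.pi μ) :=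
    iIndepFun_pi (fun i => (hf i).aemeasurable)
  have := lintegral_prod_eq_prod_lintegral_of_indepFun Finset.univ (fun i (u : ι → ℂ) => f i (u i)) hi
    (fun i => (hf i).comp (measurable_pi_apply i))
  rw [this]
  refine Finset.prod_congr rfl fun i _ => ?_
  exact (measurePreserving_eval μ i).lintegral_comp (hf i)

/-- subgaussian centred complex law -/
structure SubG (μ : Measure ℂ) (δ₀ D : ℝ) : Prop where
  prob : IsProbabilityMeasure μ
  pos : 0 < δ₀
  mean : ∫ u, u ∂μ = 0
  bd : ∫⁻ u, ee (δ₀ * ‖u‖ ^ 2) ∂μ ≤ ENNReal.ofReal D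

lemma SubG.one_le {μ : Measure ℂ} {δ₀ D : ℝ} (h : SubG μ δ₀ D) : 1 ≤ D := by
  have := h.prob
  have h1 : (1 : ℝ≥0∞) ≤ ENNReal.ofReal D := by
    calc (1 : ℝ≥0∞) = ∫⁻ _, 1 ∂μ := by simp
      _ ≤ ∫⁻ u, ee (δ₀ * ‖u‖ ^ 2) ∂μ := by
        apply lintegral_mono
        intro u
        have : (1 : ℝ≥0∞) = ee 0 := by simp [ee]
        simp only []
        rw [this]
        exact ee_mono (by have := h.pos; positivity)
      _ ≤ _ := h.bd
  rwa [ENNReal.one_le_ofReal] at h1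

lemma SubG.integrable {μ : Measure ℂ} {δ₀ D : ℝ} (h : SubG μ δ₀ D) :
    Integrable (fun u : ℂ => Real.exp (δ₀ * ‖u‖ ^ 2)) μ := by
  refine ⟨by fun_prop, ?_⟩
  rw [hasFiniteIntegral_iff_ofReal (Filter.Eventually.of_forall fun _ => (Real.exp_pos _).le)]
  exact h.bd.trans_lt ENNReal.ofReal_lt_top

lemma SubG.int_le {μ : Measure ℂ} {δ₀ D : ℝ} (h : SubG μ δ₀ D) :
    ∫ u, Real.exp (δ₀ * ‖u‖ ^ 2) ∂μ ≤ D := by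
  have h1 := ofReal_integral_eq_lintegral_ofReal h.integrable
    (Filter.Eventually.of_forall fun _ => (Real.exp_pos _).le)
  have h2 := h.bd
  unfold ee at h2
  rw [← h1, ENNReal.ofReal_le_ofReal_iff (by linarith [h.one_le])] at h2
  exact h2

lemma SubG.integrable_of_le {μ : Measure ℂ} {δ₀ D : ℝ} (h : SubG μ δ₀ D) {f : ℂ → ℝ} (hf : Measurable f)
    (C : ℝ) (hb : ∀ u, |f u| ≤ C * Real.exp (δ₀ * ‖u‖ ^ 2)) : Integrable f μ := by
  refine (h.integrable.const_mul C).mono' hf.aestronglyMeasurable (Filter.Eventually.of_forall fun u => ?_)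
  rw [Real.norm_eq_abs]; exact hb u

lemma SubG.integrable_sq {μ : Measure ℂ} {δ₀ D : ℝ} (h : SubG μ δ₀ D) :
    Integrable (fun u : ℂ => ‖u‖ ^ 2) μ := by
  have hp := h.pos
  refine h.integrable_of_le (by fun_prop) (1 / δ₀) fun u => ?_
  rw [abs_of_nonneg (by positivity)]
  have := Real.add_one_le_exp (δ₀ * ‖u‖ ^ 2)
  calc ‖u‖ ^ 2 = 1 / δ₀ * (δ₀ * ‖u‖ ^ 2) := by field_simp
    _ ≤ _ := by gcongr; linarith

lemma SubG.sq_le {μ : Measure ℂ} {δ₀ D : ℝ} (h : SubG μ δ₀ D) :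
    δ₀ * ∫ u, ‖u‖ ^ 2 ∂μ ≤ D := by
  rw [← integral_const_mul]
  refine (integral_mono (h.integrable_sq.const_mul _) h.integrable fun u => ?_).trans h.int_le
  have := Real.add_one_le_exp (δ₀ * ‖u‖ ^ 2)
  simp only []
  linarith

lemma SubG.integrable_id {μ : Measure ℂ} {δ₀ D : ℝ} (h : SubG μ δ₀ D) :
    Integrable (fun u : ℂ => u) μ := by
  have := h.prob
  refine ((integrable_const (1 : ℝ)).add h.integrable_sq).mono' (by fun_prop) (Filter.Eventually.of_forall fun u => ?_)
  simp only [Pi.add_apply]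
  nlinarith [sq_nonneg (‖u‖ - 1), norm_nonneg u]

lemma SubG.re_mean {μ : Measure ℂ} {δ₀ D : ℝ} (h : SubG μ δ₀ D) (c : ℂ) :
    ∫ u, (c * u).re ∂μ = 0 := by
  have h1 : ∫ u, RCLike.re (c * u) ∂μ = RCLike.re (∫ u, c * u ∂μ) := integral_re (h.integrable_id.const_mul c)
  have h2 : ∫ u, c * u ∂μ = 0 := by rw [integral_const_mul, h.mean, mul_zero]
  rw [h2] at h1
  simpa using h1

lemma abs_re_mul_sq (c u : ℂ) : (c * u).re ^ 2 ≤ ‖c‖ ^ 2 * ‖u‖ ^ 2 := by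
  have := Complex.abs_re_le_norm (c * u)
  rw [norm_mul] at this
  rw [← sq_abs, ← mul_pow]
  gcongr

/-- linear Laplace transform bound -/
lemma SubG.lin {μ : Measure ℂ} {δ₀ D : ℝ} (h : SubG μ δ₀ D) (c : ℂ) :
    ∫⁻ u, ee ((c * u).re) ∂μ ≤ ee ((D + 1) / δ₀ * ‖c‖ ^ 2) := by
  have := h.prob
  have hp := h.pos
  have hD := h.one_le
  have hb : ∀ u : ℂ, (c * u).re ≤ ‖c‖ ^ 2 / (4 * δ₀) + δ₀ * ‖u‖ ^ 2 := by
    intro u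
    have h1 : (c * u).re ≤ ‖c‖ * ‖u‖ := by
      rw [← norm_mul]; exact (le_abs_self _).trans (Complex.abs_re_le_norm _)
    have h2 : ‖c‖ * ‖u‖ ≤ ‖c‖ ^ 2 / (4 * δ₀) + δ₀ * ‖u‖ ^ 2 := by
      have h3 : ‖c‖ ^ 2 / (4 * δ₀) + δ₀ * ‖u‖ ^ 2 - ‖c‖ * ‖u‖ = δ₀ * (‖c‖ / (2 * δ₀) - ‖u‖) ^ 2 := by
        field_simp; ring
      have : 0 ≤ δ₀ * (‖c‖ / (2 * δ₀) - ‖u‖) ^ 2 := by positivity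
      linarith
    linarith
  have hint : Integrable (fun u : ℂ => Real.exp ((c * u).re)) μ := by
    refine h.integrable_of_le (by fun_prop) (Real.exp (‖c‖ ^ 2 / (4 * δ₀))) fun u => ?_
    rw [abs_of_pos (Real.exp_pos _), ← Real.exp_add]
    exact Real.exp_le_exp.2 (hb u)
  unfold ee
  rw [← ofReal_integral_eq_lintegral_ofReal hint (Filter.Eventually.of_forall fun _ => (Real.exp_pos _).le)]
  apply ENNReal.ofReal_le_ofReal
  rcases le_or_gt (‖c‖ ^ 2) δ₀ with hc | hc
  · set r := ‖c‖ ^ 2 / δ₀ with hr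
    have hr0 : 0 ≤ r := by positivity
    have hr1 : r ≤ 1 := (div_le_one hp).2 hc
    have hpt : ∀ u : ℂ, Real.exp ((c * u).re) ≤ (c * u).re + ((1 - r) + r * Real.exp (δ₀ * ‖u‖ ^ 2)) := by
      intro u
      have h1 := exp_le_id_add_sq ((c * u).re)
      have h2 : Real.exp ((c * u).re ^ 2) ≤ Real.exp (r * (δ₀ * ‖u‖ ^ 2)) := by
        apply Real.exp_le_exp.2
        have : r * (δ₀ * ‖u‖ ^ 2) = ‖c‖ ^ 2 * ‖u‖ ^ 2 := by rw [hr]; field_simp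
        rw [this]; exact abs_re_mul_sq c u
      have h3 := exp_jensen {()} (fun _ => r) (fun _ => δ₀ * ‖u‖ ^ 2) (fun _ _ => hr0) (by simpa using hr1)
      simp only [Finset.sum_singleton] at h3
      linarith
    have hi1 : Integrable (fun u : ℂ => (c * u).re) μ := (h.integrable_id.const_mul c).re
    have hi2 : Integrable (fun u : ℂ => (1 - r) + r * Real.exp (δ₀ * ‖u‖ ^ 2)) μ :=
      (integrable_const _).add (h.integrable.const_mul r)
    calc ∫ u, Real.exp ((c * u).re) ∂μ ≤ ∫ u, ((c * u).re + ((1 - r) + r * Real.exp (δ₀ * ‖u‖ ^ 2))) ∂μ :=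
          integral_mono hint (hi1.add hi2) hpt
      _ = (1 - r) + r * ∫ u, Real.exp (δ₀ * ‖u‖ ^ 2) ∂μ := by
          rw [integral_add hi1 hi2, h.re_mean, integral_add (integrable_const _) (h.integrable.const_mul r),
            integral_const_mul]
          simp
      _ ≤ 1 + r * D := by
          have := mul_le_mul_of_nonneg_left h.int_le hr0
          linarith
      _ ≤ 1 + r * (D + 1) := by nlinarith
      _ ≤ Real.exp (r * (D + 1)) := by linarith [Real.add_one_le_exp (r * (D + 1))]
      _ = _ := by rw [hr]; ring_nf
  · calc ∫ u, Real.exp ((c * u).re) ∂μ ≤ ∫ u, Real.exp (‖c‖ ^ 2 / (4 * δ₀)) * Real.exp (δ₀ * ‖u‖ ^ 2) ∂μ := by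
          refine integral_mono hint (h.integrable.const_mul _) fun u => ?_
          simp only []
          rw [← Real.exp_add]
          exact Real.exp_le_exp.2 (hb u)
      _ ≤ Real.exp (‖c‖ ^ 2 / (4 * δ₀)) * D := by rw [integral_const_mul]; gcongr; exact h.int_le
      _ ≤ Real.exp (‖c‖ ^ 2 / δ₀) * Real.exp (‖c‖ ^ 2 / δ₀ * D) := by
          gcongr
          · linarith
          · have h1 : 1 ≤ ‖c‖ ^ 2 / δ₀ := (one_le_div hp).2 hc.le
            have := Real.add_one_le_exp (‖c‖ ^ 2 / δ₀ * D)
            nlinarith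
      _ = _ := by rw [← Real.exp_add]; ring_nf

/-- Laplace transform of the centred square -/
lemma SubG.sq {μ : Measure ℂ} {δ₀ D : ℝ} (h : SubG μ δ₀ D) (r : ℝ) (hr : |r| ≤ 1) :
    ∫⁻ u, ee (r * (δ₀ / 2 * (‖u‖ ^ 2 - ∫ x, ‖x‖ ^ 2 ∂μ))) ∂μ ≤ ee (2 * D * Real.exp D * r ^ 2) := by
  have := h.prob
  have hp := h.pos
  have hD := h.one_le
  set σ := ∫ x, ‖x‖ ^ 2 ∂μ with hσ
  have hσ0 : 0 ≤ σ := integral_nonneg fun _ => by positivity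
  have hσD : δ₀ * σ ≤ D := h.sq_le
  have hw : ∀ u : ℂ, 2 * |δ₀ / 2 * (‖u‖ ^ 2 - σ)| ≤ δ₀ * ‖u‖ ^ 2 + D := by
    intro u
    have : |‖u‖ ^ 2 - σ| ≤ ‖u‖ ^ 2 + σ := by
      rw [abs_le]; constructor <;> nlinarith [sq_nonneg ‖u‖]
    rw [abs_mul, abs_of_pos (by positivity : 0 < δ₀ / 2)]
    nlinarith
  have hpt : ∀ u : ℂ, Real.exp (r * (δ₀ / 2 * (‖u‖ ^ 2 - σ))) ≤
      (1 + r * (δ₀ / 2 * (‖u‖ ^ 2 - σ))) + 2 * r ^ 2 * Real.exp D * Real.exp (δ₀ * ‖u‖ ^ 2) := by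
    intro u
    set x := δ₀ / 2 * (‖u‖ ^ 2 - σ) with hx
    have h1 := exp_quad (r * x)
    have h2 : Real.exp |r * x| ≤ Real.exp |x| := by
      apply Real.exp_le_exp.2
      rw [abs_mul]
      nlinarith [abs_nonneg x]
    have h3 : x ^ 2 ≤ 2 * Real.exp |x| := by
      have := Real.quadratic_le_exp_of_nonneg (abs_nonneg x)
      rw [sq_abs] at this
      linarith [abs_nonneg x]
    have h4 : (r * x) ^ 2 * Real.exp |r * x| ≤ 2 * r ^ 2 * Real.exp D * Real.exp (δ₀ * ‖u‖ ^ 2) := by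
      calc (r * x) ^ 2 * Real.exp |r * x| ≤ (r * x) ^ 2 * Real.exp |x| := by gcongr
        _ = r ^ 2 * (x ^ 2 * Real.exp |x|) := by ring
        _ ≤ r ^ 2 * ((2 * Real.exp |x|) * Real.exp |x|) := by gcongr
        _ = r ^ 2 * 2 * Real.exp (2 * |x|) := by rw [two_mul |x|, Real.exp_add]; ring
        _ ≤ r ^ 2 * 2 * Real.exp (δ₀ * ‖u‖ ^ 2 + D) := by gcongr; exact hw u
        _ = _ := by rw [Real.exp_add]; ring
    linarith
  have hi0 : Integrable (fun u : ℂ => r * (δ₀ / 2 * (‖u‖ ^ 2 - σ))) μ :=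
    (((h.integrable_sq.sub (integrable_const _)).const_mul _).const_mul _)
  have hi1 : Integrable (fun u : ℂ => 1 + r * (δ₀ / 2 * (‖u‖ ^ 2 - σ))) μ :=
    (integrable_const _).add hi0
  have hi2 := h.integrable.const_mul (2 * r ^ 2 * Real.exp D)
  have hint : Integrable (fun u : ℂ => Real.exp (r * (δ₀ / 2 * (‖u‖ ^ 2 - σ)))) μ := by
    refine (hi1.add hi2).mono' (by fun_prop) (Filter.Eventually.of_forall fun u => ?_)
    rw [Real.norm_eq_abs, abs_of_pos (Real.exp_pos _)]
    exact hpt u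
  unfold ee
  rw [← ofReal_integral_eq_lintegral_ofReal hint (Filter.Eventually.of_forall fun _ => (Real.exp_pos _).le)]
  apply ENNReal.ofReal_le_ofReal
  calc _ ≤ ∫ u, ((1 + r * (δ₀ / 2 * (‖u‖ ^ 2 - σ))) + 2 * r ^ 2 * Real.exp D * Real.exp (δ₀ * ‖u‖ ^ 2)) ∂μ :=
        integral_mono hint (hi1.add hi2) hpt
    _ = 1 + 2 * r ^ 2 * Real.exp D * ∫ u, Real.exp (δ₀ * ‖u‖ ^ 2) ∂μ := by
        rw [integral_add hi1 hi2, integral_const_mul, integral_add (integrable_const _) hi0, integral_const_mul, integral_const_mul,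
          integral_sub h.integrable_sq (integrable_const _)]
        simp [← hσ]
    _ ≤ 1 + 2 * r ^ 2 * Real.exp D * D := by gcongr; exact h.int_le
    _ ≤ Real.exp (2 * r ^ 2 * Real.exp D * D) := by linarith [Real.add_one_le_exp (2 * r ^ 2 * Real.exp D * D)]
    _ = _ := by ring_nf

lemma measurable_ee_comp {α : Type*} [MeasurableSpace α] {f : α → ℝ} (hf : Measurable f) :
    Measurable fun x => ee (f x) := measurable_ee.comp hf

lemma pi_lin {ι : Type*} [Fintype ι] {μ : ι → Measure ℂ} {δ₀ D : ℝ} (h : ∀ i, SubG (μ i) δ₀ D)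
    (c : ι → ℂ) :
    ∫⁻ u, ee ((∑ j, c j * u j).re) ∂(Measure.pi μ) ≤ ee ((D + 1) / δ₀ * ∑ j, ‖c j‖ ^ 2) := by
  have := fun i => (h i).prob
  simp only [Complex.re_sum, ee_sum, Finset.mul_sum]
  rw [lintegral_pi_prod μ (fun j x => ee ((c j * x).re)) (fun j => measurable_ee_comp (by fun_prop))]
  exact Finset.prod_le_prod' fun j _ => (h j).lin (c j)

lemma lint_gauss {b : ℝ} (hb : 0 < b) : ∫⁻ x : ℝ, ee (-b * x ^ 2) = ENNReal.ofReal √(Real.pi / b) := by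
  unfold ee
  rw [← ofReal_integral_eq_lintegral_ofReal (integrable_exp_neg_mul_sq hb)
    (Filter.Eventually.of_forall fun _ => (Real.exp_pos _).le), integral_gaussian]

lemma lint_gauss_shift (a R : ℝ) (ha : 0 ≤ a) :
    ∫⁻ x : ℝ, ee (2 * √a * x * R - x ^ 2) = ee (a * R ^ 2) * ENNReal.ofReal √Real.pi := by
  have h1 : ∀ x : ℝ, ee (2 * √a * x * R - x ^ 2) = ee (a * R ^ 2) * ee (-1 * (x - √a * R) ^ 2) := by
    intro x
    rw [← ee_add]
    congr 1
    have := Real.sq_sqrt ha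
    linear_combination (R ^ 2) * this
  simp_rw [h1]
  rw [lintegral_const_mul _ (measurable_ee_comp (by fun_prop)),
    lintegral_sub_right_eq_self (fun x => ee (-1 * x ^ 2)), lint_gauss one_pos, div_one]

lemma pi_sq_re {ι : Type*} [Fintype ι] {μ : ι → Measure ℂ} {δ₀ D : ℝ} (h : ∀ i, SubG (μ i) δ₀ D)
    (c : ι → ℂ) (hc : ∑ j, ‖c j‖ ^ 2 ≤ 1) {a : ℝ} (ha : 0 ≤ a) (haK : 8 * a * ((D + 1) / δ₀) ≤ 1) :
    ∫⁻ u, ee (a * (∑ j, c j * u j).re ^ 2) ∂(Measure.pi μ) ≤ 2 := by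
  have := fun i => (h i).prob
  have hpi : (0 : ℝ) < √Real.pi := Real.sqrt_pos.2 Real.pi_pos
  have hpi' : ENNReal.ofReal √Real.pi ≠ 0 := by simpa using hpi
  rw [← ENNReal.mul_le_mul_iff_left hpi' ENNReal.ofReal_ne_top, ← lintegral_mul_const _ (measurable_ee_comp (by fun_prop))]
  simp_rw [← lint_gauss_shift a _ ha]
  rw [lintegral_lintegral_swap]
  · have hx : ∀ x : ℝ, ∫⁻ u, ee (2 * √a * x * (∑ j, c j * u j).re - x ^ 2) ∂(Measure.pi μ) ≤ ee (-(1 / 2) * x ^ 2) := by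
      intro x
      have h1 : ∀ u : ι → ℂ, ee (2 * √a * x * (∑ j, c j * u j).re - x ^ 2) =
          ee (- x ^ 2) * ee ((∑ j, ((2 * √a * x : ℝ) * c j) * u j).re) := by
        intro u
        rw [← ee_add]
        congr 1
        have : ∑ j, ((2 * √a * x : ℝ) * c j) * u j = (2 * √a * x : ℝ) * ∑ j, c j * u j := by
          rw [Finset.mul_sum]; refine Finset.sum_congr rfl fun j _ => by ring
        rw [this, Complex.re_ofReal_mul]
        ring
      simp_rw [h1]
      rw [lintegral_const_mul _ (measurable_ee_comp (by fun_prop))]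
      refine (mul_le_mul_right (pi_lin h _) _).trans ?_
      rw [← ee_add]
      apply ee_mono
      have h2 : ∑ j, ‖((2 * √a * x : ℝ) : ℂ) * c j‖ ^ 2 = 4 * a * x ^ 2 * ∑ j, ‖c j‖ ^ 2 := by
        rw [Finset.mul_sum]
        refine Finset.sum_congr rfl fun j _ => ?_
        rw [norm_mul, mul_pow, Complex.norm_real, Real.norm_eq_abs, sq_abs]
        have := Real.sq_sqrt ha
        linear_combination (4 * x ^ 2 * ‖c j‖ ^ 2) * this
      rw [h2]
      cases isEmpty_or_nonempty ι with
      | inl he => simp; nlinarith [sq_nonneg x]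
      | inr hne =>
        obtain ⟨i⟩ := hne
        have hK : 0 ≤ (D + 1) / δ₀ := div_nonneg (by linarith [(h i).one_le]) (h i).pos.le
        have h3 : (D + 1) / δ₀ * (4 * a * x ^ 2 * ∑ j, ‖c j‖ ^ 2) ≤ (D + 1) / δ₀ * (4 * a * x ^ 2 * 1) := by gcongr
        nlinarith [mul_le_mul_of_nonneg_right haK (sq_nonneg x)]
    refine (lintegral_mono hx).trans ?_
    rw [lint_gauss (by norm_num)]
    rw [show (2 : ℝ≥0∞) = ENNReal.ofReal 2 by simp, ← ENNReal.ofReal_mul (by norm_num)]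
    apply ENNReal.ofReal_le_ofReal
    rw [Real.sqrt_le_left (by positivity), mul_pow, Real.sq_sqrt Real.pi_pos.le]
    linarith [Real.pi_pos]
  · apply Measurable.aemeasurable
    apply measurable_ee_comp
    fun_prop

lemma pi_sq {ι : Type*} [Fintype ι] {μ : ι → Measure ℂ} {δ₀ D : ℝ} (h : ∀ i, SubG (μ i) δ₀ D)
    (c : ι → ℂ) (hc : ∑ j, ‖c j‖ ^ 2 ≤ 1) {a : ℝ} (ha : 0 ≤ a) (haK : 16 * a * ((D + 1) / δ₀) ≤ 1) :
    ∫⁻ u, ee (a * ‖∑ j, c j * u j‖ ^ 2) ∂(Measure.pi μ) ≤ 4 := by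
  have := fun i => (h i).prob
  have h1 : ∀ u : ι → ℂ, ee (a * ‖∑ j, c j * u j‖ ^ 2) ≤
      ee ((2 * a) * (∑ j, c j * u j).re ^ 2) + ee ((2 * a) * (∑ j, (-Complex.I * c j) * u j).re ^ 2) := by
    intro u
    have e1 : (∑ j, (-Complex.I * c j) * u j) = -Complex.I * ∑ j, c j * u j := by
      rw [Finset.mul_sum]; refine Finset.sum_congr rfl fun j _ => by ring
    have e2 : (-Complex.I * ∑ j, c j * u j).re = (∑ j, c j * u j).im := by
      simp
    rw [e1, e2]
    refine le_trans (le_of_eq ?_) (ee_half _ _)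
    congr 1
    rw [← Complex.normSq_eq_norm_sq, Complex.normSq_apply]
    ring
  refine (lintegral_mono h1).trans ?_
  rw [lintegral_add_left (measurable_ee_comp (by fun_prop))]
  have h2 := pi_sq_re h c hc (a := 2 * a) (by linarith) (by linarith)
  have h3 := pi_sq_re h (fun j => -Complex.I * c j) (by simpa using hc) (a := 2 * a) (by linarith) (by linarith)
  calc _ ≤ (2 : ℝ≥0∞) + 2 := add_le_add h2 h3
    _ = 4 := by norm_num

/-- one decoupled piece -/
lemma decoupled {ι : Type*} [Fintype ι] {μ : ι → Measure ℂ} {δ₀ D : ℝ} (h : ∀ i, SubG (μ i) δ₀ D)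
    (A : ι → ι → ℂ) (hA : ∑ j, ∑ k, ‖A j k‖ ^ 2 ≤ 1) (S : ι → Bool) {t : ℝ} (ht : 16 * t ^ 2 * ((D + 1) / δ₀) ^ 2 ≤ 1)  :
    ∫⁻ u, ee (t * (∑ j, ∑ k, (if S j = true ∧ S k = false then A j k * (starRingEnd ℂ (u j) * u k) else 0)).re)
      ∂(Measure.pi μ) ≤ 5 := by
  have := fun i => (h i).prob
  set K := (D + 1) / δ₀ with hK
  rw [resample μ (fun i => S i = true) (measurable_ee_comp (by
    apply Measurable.const_mul
    apply Complex.measurable_re.comp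
    refine Finset.measurable_sum _ fun j _ => Finset.measurable_sum _ fun k _ => ?_
    split_ifs <;> fun_prop))]
  set c : ι → (ι → ℂ) → ℂ := fun j u => if S j = true then ∑ k, (if S k = false then A j k else 0) * u k else 0 with hc
  have hcm : ∀ j, Measurable (c j) := by
    intro j; rw [hc]; simp only; split_ifs <;> fun_prop
  have h1 : ∀ u' u : ι → ℂ,
      (t * (∑ j, ∑ k, (if S j = true ∧ S k = false then A j k *
        (starRingEnd ℂ ((if S j = true then u j else u' j)) * (if S k = true then u k else u' k)) else 0)).re)
      = (∑ j, (t * starRingEnd ℂ (c j u')) * u j).re := by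
    intro u' u
    rw [← Complex.re_ofReal_mul, ← Complex.conj_re]
    congr 1
    rw [map_mul, map_sum, Finset.mul_sum, Complex.conj_ofReal]
    refine Finset.sum_congr rfl fun j _ => ?_
    rw [mul_assoc]
    congr 1
    rw [hc]
    simp only
    by_cases hj : S j = true
    · simp only [hj, if_true, true_and]
      rw [map_sum, map_sum, Finset.sum_mul]
      refine Finset.sum_congr rfl fun k _ => ?_
      by_cases hk : S k = true
      · simp [hk]
      · simp [hk]; ring
    · simp [hj]
  simp_rw [h1]
  set τ : ι → ℝ := fun j => ∑ k, ‖A j k‖ ^ 2 with hτ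
  have hτ0 : ∀ j, 0 ≤ τ j := fun j => Finset.sum_nonneg fun _ _ => by positivity
  cases isEmpty_or_nonempty ι with
  | inl he => simp [ee]
  | inr hne =>
  obtain ⟨i0⟩ := hne
  have hK0 : 0 ≤ K := div_nonneg (by linarith [(h i0).one_le]) (h i0).pos.le
  -- normalised coefficients
  set d : ι → ι → ℂ := fun j k => if S j = true then (if S k = false then A j k else 0) / (√(τ j) : ℝ) else 0 with hd
  have hdn : ∀ j, ∑ k, ‖d j k‖ ^ 2 ≤ 1 := by
    intro j
    have : ∀ k, ‖d j k‖ ^ 2 ≤ ‖A j k‖ ^ 2 / τ j := by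
      intro k
      rw [hd]; simp only
      split_ifs
      · rw [norm_div, div_pow, Complex.norm_real, Real.norm_eq_abs, sq_abs, Real.sq_sqrt (hτ0 j)]
      · simp; have := hτ0 j; positivity
      · simp; have := hτ0 j; positivity
    refine (Finset.sum_le_sum fun k _ => this k).trans ?_
    rw [← Finset.sum_div]
    exact div_self_le_one _
  have hdc : ∀ j u, ‖c j u‖ ^ 2 = τ j * ‖∑ k, d j k * u k‖ ^ 2 := by
    intro j u
    rcases (hτ0 j).eq_or_lt with h0 | h0
    · have hz : ∀ k, A j k = 0 := by
        intro k
        have := (Finset.sum_eq_zero_iff_of_nonneg (fun k _ => by positivity)).1 h0.symm k (Finset.mem_univ k)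
        simpa using this
      rw [← h0]
      simp [hc, hz]
    · by_cases hj : S j = true
      · have hs : ((√(τ j) : ℝ) : ℂ) ≠ 0 := by
          have := Real.sqrt_pos.2 h0
          exact_mod_cast this.ne'
        have : c j u = (√(τ j) : ℝ) * ∑ k, d j k * u k := by
          rw [hc, hd, Finset.mul_sum]
          simp only [hj, if_true]
          refine Finset.sum_congr rfl fun k _ => ?_
          field_simp
        rw [this, norm_mul, mul_pow, Complex.norm_real, Real.norm_eq_abs, sq_abs, Real.sq_sqrt (hτ0 j)]
      · simp [hc, hd, hj]
  have h2 : ∀ u' : ι → ℂ, ∫⁻ u, ee ((∑ j, (t * starRingEnd ℂ (c j u')) * u j).re) ∂(Measure.pi μ)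
      ≤ 1 + ∑ j, ENNReal.ofReal (τ j) * ee (K * t ^ 2 * ‖∑ k, d j k * u' k‖ ^ 2) := by
    intro u'
    refine (pi_lin h _).trans ?_
    have e1 : K * ∑ j, ‖(t : ℂ) * starRingEnd ℂ (c j u')‖ ^ 2 = ∑ j, τ j * (K * t ^ 2 * ‖∑ k, d j k * u' k‖ ^ 2) := by
      rw [Finset.mul_sum]
      refine Finset.sum_congr rfl fun j _ => ?_
      rw [norm_mul, mul_pow, RCLike.norm_conj, hdc, Complex.norm_real, Real.norm_eq_abs, sq_abs]
      ring
    rw [e1]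
    have e2 := exp_jensen Finset.univ τ (fun j => K * t ^ 2 * ‖∑ k, d j k * u' k‖ ^ 2) (fun j _ => hτ0 j) hA
    have hs0 : 0 ≤ ∑ j, τ j := Finset.sum_nonneg fun j _ => hτ0 j
    unfold ee
    calc _ ≤ ENNReal.ofReal (1 + ∑ j, τ j * Real.exp (K * t ^ 2 * ‖∑ k, d j k * u' k‖ ^ 2)) :=
          ENNReal.ofReal_le_ofReal (e2.trans (by linarith))
      _ = _ := by
          rw [ENNReal.ofReal_add one_pos.le (Finset.sum_nonneg fun j _ => mul_nonneg (hτ0 j) (Real.exp_pos _).le),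
            ENNReal.ofReal_one, ENNReal.ofReal_sum_of_nonneg (fun j _ => mul_nonneg (hτ0 j) (Real.exp_pos _).le)]
          simp_rw [ENNReal.ofReal_mul (hτ0 _)]
  refine (lintegral_mono h2).trans ?_
  rw [lintegral_add_left measurable_const, lintegral_finsetSum _ (fun j _ => (measurable_ee_comp (by fun_prop)).const_mul _)]
  have hlc : ∀ j, ∫⁻ u' : ι → ℂ, ENNReal.ofReal (τ j) * ee (K * t ^ 2 * ‖∑ k, d j k * u' k‖ ^ 2) ∂(Measure.pi μ)
      = ENNReal.ofReal (τ j) * ∫⁻ u' : ι → ℂ, ee (K * t ^ 2 * ‖∑ k, d j k * u' k‖ ^ 2) ∂(Measure.pi μ) :=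
    fun j => lintegral_const_mul _ (measurable_ee_comp (by fun_prop))
  simp_rw [hlc]
  have h3 : ∀ j, ∫⁻ u', ee (K * t ^ 2 * ‖∑ k, d j k * u' k‖ ^ 2) ∂(Measure.pi μ) ≤ 4 := by
    intro j
    apply pi_sq h _ (hdn j) (by positivity)
    rw [← hK]
    nlinarith
  calc _ ≤ (1 : ℝ≥0∞) + ∑ j, ENNReal.ofReal (τ j) * 4 := by
        gcongr with j _
        · simp
        · exact h3 j
    _ ≤ 1 + 1 * 4 := by
        rw [← Finset.sum_mul, ← ENNReal.ofReal_sum_of_nonneg (fun j _ => hτ0 j)]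
        gcongr
        rw [ENNReal.ofReal_le_one]; exact hA
    _ = 5 := by norm_num

lemma count_bool {ι : Type*} [Fintype ι] [DecidableEq ι] {j k : ι} (hjk : j ≠ k) :
    4 * ∑ S : ι → Bool, (if S j = true ∧ S k = false then (1 : ℂ) else 0) = Fintype.card (ι → Bool) := by
  have tog : ∀ l : ι, Function.Involutive (fun (S : ι → Bool) => Function.update S l (!S l)) := by
    intro l S
    simp
  have hs : ∀ (l : ι) (f : (ι → Bool) → ℂ), ∑ S, f (Function.update S l (!S l)) = ∑ S, f S := by
    intro l f
    exact Equiv.sum_comp (tog l).toPerm f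
  have h1 := hs j (fun S => if S j = true ∧ S k = false then (1 : ℂ) else 0)
  have h2 := hs k (fun S => if S j = true ∧ S k = false then (1 : ℂ) else 0)
  have h3 := hs k (fun S => if S j = false ∧ S k = false then (1 : ℂ) else 0)
  simp only [Function.update_self, Function.update_of_ne hjk, Function.update_of_ne hjk.symm] at h1 h2 h3
  have h4 : ∑ S : ι → Bool, (1 : ℂ) = Fintype.card (ι → Bool) := by simp
  have h5 : ∀ S : ι → Bool, (1 : ℂ) = (if S j = true ∧ S k = false then (1 : ℂ) else 0)
     + (if (!S j) = true ∧ S k = false then (1 : ℂ) else 0)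
     + (if S j = true ∧ (!S k) = false then (1 : ℂ) else 0)
     + (if S j = false ∧ (!S k) = false then (1 : ℂ) else 0) := by
    intro S
    cases S j <;> cases S k <;> simp
  rw [Finset.sum_congr rfl (fun S _ => h5 S), Finset.sum_add_distrib, Finset.sum_add_distrib,
    Finset.sum_add_distrib, h1, h2, h3] at h4
  have h6 : ∑ S : ι → Bool, (if S j = false ∧ S k = false then (1 : ℂ) else 0) =
     ∑ S : ι → Bool, (if (!S j) = true ∧ S k = false then (1 : ℂ) else 0) := by
    refine Finset.sum_congr rfl fun S _ => ?_
    cases S j <;> simp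
  rw [h6, h1] at h4
  linear_combination h4

lemma offdiag_bound {ι : Type*} [Fintype ι] [DecidableEq ι] {μ : ι → Measure ℂ} {δ₀ D : ℝ} (h : ∀ i, SubG (μ i) δ₀ D)
    (A : ι → ι → ℂ) (hA : ∑ j, ∑ k, ‖A j k‖ ^ 2 ≤ 1) {t : ℝ} (ht : 256 * t ^ 2 * ((D + 1) / δ₀) ^ 2 ≤ 1) :
    ∫⁻ u, ee (t * (∑ j, ∑ k, (if j = k then 0 else A j k * (starRingEnd ℂ (u j) * u k))).re)
      ∂(Measure.pi μ) ≤ 5 := by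
  have := fun i => (h i).prob
  set n : ℝ := ((Fintype.card (ι → Bool) : ℕ) : ℝ) with hn
  have hn0 : 0 < n := by rw [hn]; exact_mod_cast Fintype.card_pos
  set Q : (ι → Bool) → (ι → ℂ) → ℂ := fun S u =>
    ∑ j, ∑ k, (if S j = true ∧ S k = false then A j k * (starRingEnd ℂ (u j) * u k) else 0) with hQ
  have hQm : ∀ S, Measurable (Q S) := by
    intro S
    refine Finset.measurable_sum _ fun j _ => Finset.measurable_sum _ fun k _ => ?_
    split_ifs <;> fun_prop
  have h1 : ∀ u : ι → ℂ, t * (∑ j, ∑ k, (if j = k then 0 else A j k * (starRingEnd ℂ (u j) * u k))).re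
      = ∑ S, (1 / n) * ((4 * t) * (Q S u).re) := by
    intro u
    have e1 : (n : ℂ) * (∑ j, ∑ k, (if j = k then 0 else A j k * (starRingEnd ℂ (u j) * u k)))
        = 4 * ∑ S, Q S u := by
      have e0 : ∑ S, Q S u = ∑ j, ∑ k, ∑ S : ι → Bool,
          (if S j = true ∧ S k = false then A j k * (starRingEnd ℂ (u j) * u k) else 0) := by
        rw [hQ]
        simp only
        rw [Finset.sum_comm]
        refine Finset.sum_congr rfl fun j _ => ?_
        rw [Finset.sum_comm]
      rw [e0, Finset.mul_sum, Finset.mul_sum]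
      refine Finset.sum_congr rfl fun j _ => ?_
      rw [Finset.mul_sum, Finset.mul_sum]
      refine Finset.sum_congr rfl fun k _ => ?_
      by_cases hjk : j = k
      · subst hjk
        have : ∀ S : ι → Bool, ¬ (S j = true ∧ S j = false) := by intro S; cases S j <;> simp
        simp [this]
      · have e2 := count_bool hjk
        simp only [hjk, if_false]
        rw [hn]
        push_cast
        rw [← e2]
        have : ∀ S : ι → Bool, (if S j = true ∧ S k = false then A j k * (starRingEnd ℂ (u j) * u k) else 0)
          = (if S j = true ∧ S k = false then (1 : ℂ) else 0) * (A j k * (starRingEnd ℂ (u j) * u k)) := by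
          intro S; split_ifs <;> simp
        simp_rw [this]
        rw [← Finset.sum_mul]; ring
    have e3 := congrArg Complex.re e1
    rw [Complex.re_ofReal_mul] at e3
    have e4 : (4 * ∑ S, Q S u).re = 4 * ∑ S, (Q S u).re := by
      rw [show (4 : ℂ) = ((4 : ℝ) : ℂ) by norm_num, Complex.re_ofReal_mul, Complex.re_sum]
    rw [e4] at e3
    rw [← Finset.mul_sum, ← Finset.mul_sum]
    generalize (∑ j, ∑ k, (if j = k then 0 else A j k * (starRingEnd ℂ (u j) * u k))).re = X at e3 ⊢
    generalize ∑ S, (Q S u).re = Y at e3 ⊢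
    field_simp
    linear_combination t * e3
  simp_rw [h1]
  have hw : ∑ S : ι → Bool, (1 / n) = 1 := by
    simp only [Finset.sum_const, Finset.card_univ, nsmul_eq_mul]
    rw [← hn]; field_simp
  have h2 : ∀ u : ι → ℂ, ee (∑ S, (1 / n) * ((4 * t) * (Q S u).re)) ≤
      ∑ S, ENNReal.ofReal (1 / n) * ee ((4 * t) * (Q S u).re) := by
    intro u
    have e := exp_jensen Finset.univ (fun _ : ι → Bool => 1 / n) (fun S => (4 * t) * (Q S u).re)
      (fun _ _ => by positivity) hw.le
    rw [hw, sub_self, zero_add] at e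
    refine (ENNReal.ofReal_le_ofReal e).trans ?_
    rw [ENNReal.ofReal_sum_of_nonneg (fun S _ => by positivity)]
    simp_rw [ENNReal.ofReal_mul (by positivity : 0 ≤ 1 / n)]
    rfl
  refine (lintegral_mono h2).trans ?_
  have hQe : ∀ S, Measurable fun u => ee ((4 * t) * (Q S u).re) := fun S =>
    measurable_ee_comp ((Complex.measurable_re.comp (hQm S)).const_mul _)
  rw [lintegral_finsetSum _ (fun S _ => (hQe S).const_mul _)]
  have h3 : ∀ S, ∫⁻ u, ENNReal.ofReal (1 / n) * ee ((4 * t) * (Q S u).re) ∂(Measure.pi μ) ≤ ENNReal.ofReal (1 / n) * 5 := by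
    intro S
    rw [lintegral_const_mul _ (hQe S)]
    gcongr
    exact decoupled h A hA S (t := 4 * t) (by linarith)
  refine (Finset.sum_le_sum fun S _ => h3 S).trans ?_
  rw [← Finset.sum_mul, ← ENNReal.ofReal_sum_of_nonneg (fun S _ => by positivity), hw]
  simp

lemma diag_bound {ι : Type*} [Fintype ι] {μ : ι → Measure ℂ} {δ₀ D : ℝ} (h : ∀ i, SubG (μ i) δ₀ D)
    (a : ι → ℂ) (ha : ∑ j, ‖a j‖ ^ 2 ≤ 1) (hD : 1 ≤ D) (hδ : 0 < δ₀) {t : ℝ} (ht0 : 0 ≤ t) (ht : t ≤ δ₀ / 2) :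
    ∫⁻ u, ee (t * (∑ j, a j * ((‖u j‖ ^ 2 - ∫ x, ‖x‖ ^ 2 ∂(μ j) : ℝ) : ℂ)).re) ∂(Measure.pi μ) ≤ ee (2 * D * Real.exp D) := by
  have := fun i => (h i).prob
  set r : ι → ℝ := fun j => t / (δ₀ / 2) * (a j).re with hr
  have htt : t / (δ₀ / 2) ≤ 1 := (div_le_one (by positivity)).2 ht
  have htt0 : 0 ≤ t / (δ₀ / 2) := by positivity
  have hra : ∀ j, |r j| ≤ ‖a j‖ := by
    intro j
    rw [hr]; simp only
    rw [abs_mul, abs_of_nonneg htt0]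
    calc _ ≤ 1 * |(a j).re| := by gcongr
      _ ≤ _ := by rw [one_mul]; exact Complex.abs_re_le_norm _
  have hr2 : ∀ j, r j ^ 2 ≤ ‖a j‖ ^ 2 := fun j => by rw [← sq_abs]; have := hra j; gcongr
  have hr1 : ∀ j, |r j| ≤ 1 := by
    intro j
    have h1 : ‖a j‖ ^ 2 ≤ 1 := (Finset.single_le_sum (f := fun j => ‖a j‖ ^ 2) (fun _ _ => by positivity) (Finset.mem_univ j)).trans ha
    have h2 : ‖a j‖ ≤ 1 := by nlinarith [norm_nonneg (a j)]
    exact (hra j).trans h2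
  have h1 : ∀ u : ι → ℂ, t * (∑ j, a j * ((‖u j‖ ^ 2 - ∫ x, ‖x‖ ^ 2 ∂(μ j) : ℝ) : ℂ)).re =
      ∑ j, r j * (δ₀ / 2 * (‖u j‖ ^ 2 - ∫ x, ‖x‖ ^ 2 ∂(μ j))) := by
    intro u
    rw [Complex.re_sum, Finset.mul_sum]
    refine Finset.sum_congr rfl fun j _ => ?_
    rw [Complex.re_mul_ofReal, hr]
    simp only
    field_simp
  simp_rw [h1, ee_sum]
  rw [lintegral_pi_prod μ (fun j x => ee (r j * (δ₀ / 2 * (‖x‖ ^ 2 - ∫ x, ‖x‖ ^ 2 ∂(μ j))))) (fun j => measurable_ee_comp (by fun_prop))]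
  refine (Finset.prod_le_prod' fun j _ => (h j).sq (r j) (hr1 j)).trans ?_
  rw [← ee_sum]
  apply ee_mono
  rw [← Finset.mul_sum]
  have : ∑ j, r j ^ 2 ≤ 1 := (Finset.sum_le_sum fun j _ => hr2 j).trans ha
  have h3 : 0 ≤ 2 * D * Real.exp D := by positivity
  nlinarith

/-- centred quadratic form -/
def cqf {ι : Type*} [Fintype ι] (μ : ι → Measure ℂ) (A : ι → ι → ℂ) (u : ι → ℂ) : ℂ :=
  ∑ j, ∑ k, A j k * (starRingEnd ℂ (u j) * u k) - ∑ j, A j j * ((∫ x, ‖x‖ ^ 2 ∂(μ j) : ℝ) : ℂ)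

lemma cqf_smul {ι : Type*} [Fintype ι] (μ : ι → Measure ℂ) (A : ι → ι → ℂ) (u : ι → ℂ) (c : ℂ) :
    cqf μ (fun j k => c * A j k) u = c * cqf μ A u := by
  simp only [cqf, mul_sub, Finset.mul_sum, mul_assoc]

lemma cqf_meas {ι : Type*} [Fintype ι] (μ : ι → Measure ℂ) (A : ι → ι → ℂ) : Measurable (cqf μ A) := by
  unfold cqf; fun_prop

lemma cqf_split {ι : Type*} [Fintype ι] [DecidableEq ι] (μ : ι → Measure ℂ) (A : ι → ι → ℂ) (u : ι → ℂ) :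
    cqf μ A u = ∑ j, ∑ k, (if j = k then 0 else A j k * (starRingEnd ℂ (u j) * u k)) +
      ∑ j, A j j * ((‖u j‖ ^ 2 - ∫ x, ‖x‖ ^ 2 ∂(μ j) : ℝ) : ℂ) := by
  unfold cqf
  rw [← Finset.sum_sub_distrib, ← Finset.sum_add_distrib]
  refine Finset.sum_congr rfl fun j _ => ?_
  have h1 : ∑ k, A j k * (starRingEnd ℂ (u j) * u k) =
      ∑ k, (if j = k then 0 else A j k * (starRingEnd ℂ (u j) * u k)) + A j j * (starRingEnd ℂ (u j) * u j) := by
    have : ∀ k, A j k * (starRingEnd ℂ (u j) * u k) = (if j = k then 0 else A j k * (starRingEnd ℂ (u j) * u k))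
       + (if j = k then A j k * (starRingEnd ℂ (u j) * u k) else 0) := by intro k; split_ifs <;> simp
    rw [Finset.sum_congr rfl (fun k _ => this k), Finset.sum_add_distrib]
    simp
  rw [h1, Complex.conj_mul']
  push_cast
  ring

lemma quad_re {ι : Type*} [Fintype ι] {μ : ι → Measure ℂ} {δ₀ D : ℝ} (h : ∀ i, SubG (μ i) δ₀ D)
    (A : ι → ι → ℂ) (hA : ∑ j, ∑ k, ‖A j k‖ ^ 2 ≤ 1) (hD : 1 ≤ D) (hδ : 0 < δ₀) {t : ℝ} (ht0 : 0 ≤ t) (ht : t ≤ δ₀ / 4)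
    (ht' : 1024 * t ^ 2 * ((D + 1) / δ₀) ^ 2 ≤ 1) :
    ∫⁻ u, ee (t * (cqf μ A u).re) ∂(Measure.pi μ) ≤ 5 + ee (2 * D * Real.exp D) := by
  classical
  have := fun i => (h i).prob
  have h1 : ∀ u, ee (t * (cqf μ A u).re) ≤
    ee ((2 * t) * (∑ j, ∑ k, (if j = k then 0 else A j k * (starRingEnd ℂ (u j) * u k))).re) +
    ee ((2 * t) * (∑ j, A j j * ((‖u j‖ ^ 2 - ∫ x, ‖x‖ ^ 2 ∂(μ j) : ℝ) : ℂ)).re) := by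
    intro u
    rw [cqf_split, Complex.add_re]
    refine le_trans (le_of_eq ?_) (ee_half _ _)
    congr 1
    ring
  refine (lintegral_mono h1).trans ?_
  rw [lintegral_add_right _ (measurable_ee_comp (by fun_prop))]
  apply add_le_add
  · exact offdiag_bound h A hA (by linarith)
  · apply diag_bound h (fun j => A j j) _ hD hδ (by linarith) (by linarith)
    refine le_trans ?_ hA
    exact Finset.sum_le_sum fun j _ => Finset.single_le_sum (f := fun k => ‖A j k‖ ^ 2) (fun _ _ => by positivity) (Finset.mem_univ j)

lemma quad_norm {ι : Type*} [Fintype ι] {μ : ι → Measure ℂ} {δ₀ D : ℝ} (h : ∀ i, SubG (μ i) δ₀ D)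
    (A : ι → ι → ℂ) (hA : ∑ j, ∑ k, ‖A j k‖ ^ 2 ≤ 1) (hD : 1 ≤ D) (hδ : 0 < δ₀) {t : ℝ} (ht0 : 0 ≤ t) (ht : t ≤ δ₀ / 4)
    (ht' : 1024 * t ^ 2 * ((D + 1) / δ₀) ^ 2 ≤ 1) :
    ∫⁻ u, ee (t / 2 * ‖cqf μ A u‖) ∂(Measure.pi μ) ≤ 4 * (5 + ee (2 * D * Real.exp D)) := by
  have := fun i => (h i).prob
  set M := 5 + ee (2 * D * Real.exp D)
  have hm : ∀ B : ι → ι → ℂ, Measurable fun u => ee (t * (cqf μ B u).re) := fun B =>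
    measurable_ee_comp ((Complex.measurable_re.comp (cqf_meas μ B)).const_mul _)
  have h1 : ∀ u, ee (t / 2 * ‖cqf μ A u‖) ≤
      (ee (t * (cqf μ (fun j k => 1 * A j k) u).re) + ee (t * (cqf μ (fun j k => (-1) * A j k) u).re)) +
      (ee (t * (cqf μ (fun j k => (-Complex.I) * A j k) u).re) + ee (t * (cqf μ (fun j k => Complex.I * A j k) u).re)) := by
    intro u
    simp only [cqf_smul]
    set x := cqf μ A u
    have e1 : t / 2 * ‖x‖ ≤ (|t * x.re| + |t * x.im|) / 2 := by
      rw [abs_mul, abs_mul, abs_of_nonneg ht0]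
      nlinarith [Complex.norm_le_abs_re_add_abs_im x]
    refine (ee_mono e1).trans ((ee_half _ _).trans ?_)
    refine add_le_add ((ee_abs _).trans (le_of_eq ?_)) ((ee_abs _).trans (le_of_eq ?_))
    · simp
    · simp
  refine (lintegral_mono h1).trans ?_
  have hm2 : Measurable fun u => ee (t*(cqf μ (fun j k => 1*A j k) u).re) + ee (t*(cqf μ (fun j k => (-1)*A j k) u).re) := (hm _).add (hm _)
  rw [lintegral_add_left hm2, lintegral_add_left (hm _), lintegral_add_left (hm _)]
  have hq : ∀ c : ℂ, ‖c‖ = 1 → ∫⁻ u, ee (t * (cqf μ (fun j k => c * A j k) u).re) ∂(Measure.pi μ) ≤ M := by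
    intro c hc
    apply quad_re h _ _ hD hδ ht0 ht ht'
    simpa [hc] using hA
  calc _ ≤ (M + M) + (M + M) := add_le_add (add_le_add (hq _ (by simp)) (hq _ (by simp)))
        (add_le_add (hq _ (by simp)) (hq _ (by simp)))
    _ = 4 * M := by ring

lemma quad_form (δ₀ D : ℝ) (hδ : 0 < δ₀) (hD : 1 ≤ D) : ∃ θ C : ℝ, 0 < θ ∧ 0 < C ∧
    ∀ (N : ℕ) (μ : Fin N → Measure ℂ) (_ : ∀ i, SubG (μ i) δ₀ D) (A : Fin N → Fin N → ℂ),
      ∑ j, ∑ k, ‖A j k‖ ^ 2 ≤ 1 → ∫⁻ u, ee (θ * ‖cqf μ A u‖) ∂(Measure.pi μ) ≤ ENNReal.ofReal C := by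
  have hK : 0 < (D + 1) / δ₀ := by positivity
  set t := min (δ₀ / 4) (1 / (32 * ((D + 1) / δ₀))) with ht
  have ht0 : 0 < t := lt_min (by positivity) (by positivity)
  refine ⟨t / 2, 4 * (5 + Real.exp (2 * D * Real.exp D)), by positivity, by positivity, ?_⟩
  intro N μ h A hA
  refine (quad_norm h A hA hD hδ ht0.le (min_le_left _ _) ?_).trans (le_of_eq ?_)
  · have h1 : t * (32 * ((D + 1) / δ₀)) ≤ 1 := by
      have := min_le_right (δ₀ / 4) (1 / (32 * ((D + 1) / δ₀)))
      rw [← ht, le_div_iff₀ (by positivity)] at this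
      exact this
    have h2 : 0 ≤ t * (32 * ((D + 1) / δ₀)) := by positivity
    calc 1024 * t ^ 2 * ((D + 1) / δ₀) ^ 2 = (t * (32 * ((D + 1) / δ₀))) ^ 2 := by ring
      _ ≤ 1 := pow_le_one₀ h2 h1
  · rw [ENNReal.ofReal_mul (by norm_num), ENNReal.ofReal_add (by norm_num) (Real.exp_pos _).le]
    simp [ee]

abbrev TT (N : ℕ) := {p : Fin N × Fin N // p.1 ≤ p.2}

/-- Hermitian matrix built from the upper triangle -/
def Hm {N : ℕ} (x : TT N → ℂ) : Matrix (Fin N) (Fin N) ℂ := fun i j =>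
  if h : i < j then x ⟨(i, j), h.le⟩ else if h' : j < i then starRingEnd ℂ (x ⟨(j, i), h'.le⟩)
    else ((x ⟨(i, j), not_lt.1 h'⟩).re : ℂ)

lemma Hm_herm {N : ℕ} (x : TT N → ℂ) : (Hm x).IsHermitian := by
  ext i j
  simp only [Matrix.conjTranspose_apply, Hm]
  rcases lt_trichotomy i j with h | h | h
  · simp [h, h.not_gt]
  · subst h; simp
  · simp [h, h.not_gt]

lemma Hm_meas {N : ℕ} (i j : Fin N) : Measurable fun x : TT N → ℂ => Hm x i j := by
  unfold Hm
  split_ifs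
  · fun_prop
  · exact Complex.continuous_conj.measurable.comp (measurable_pi_apply _)
  · exact Complex.measurable_ofReal.comp (Complex.measurable_re.comp (measurable_pi_apply _))

lemma Hm_diag {N : ℕ} (x : TT N → ℂ) (i : Fin N) : Hm x i i = ((x ⟨(i, i), le_refl i⟩).re : ℂ) := by
  simp [Hm]

def sp {N : ℕ} (i j : Fin N) : TT N := if h : i ≤ j then ⟨(i, j), h⟩ else ⟨(j, i), le_of_not_ge h⟩

def phi {N : ℕ} (i j : Fin N) (y : ℂ) : ℂ := if j = i then 0 else if j < i then y else starRingEnd ℂ y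

lemma phi_meas {N : ℕ} (i j : Fin N) : Measurable (phi i j) := by
  unfold phi
  split_ifs
  · fun_prop
  · fun_prop
  · exact Complex.continuous_conj.measurable

lemma colv_eq {N : ℕ} (x : TT N → ℂ) (i j : Fin N) : colv i (Hm x) j = phi i j (x (sp i j)) := by
  simp only [colv, phi, Hm, sp]
  rcases lt_trichotomy i j with h | h | h
  · simp [h, h.not_gt, h.ne', h.le]
  · subst h; simp
  · simp [h, h.not_gt, h.ne, h.not_ge]

lemma sp_inj {N : ℕ} (i : Fin N) : Function.Injective (sp i) := by
  intro j k h
  simp only [sp] at h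
  split_ifs at h <;> simp only [Subtype.mk.injEq, Prod.mk.injEq] at h <;> grind

structure Model (N : ℕ) (μ : TT N → Measure ℂ) (δ₀ D : ℝ) : Prop where
  prob : ∀ p, IsProbabilityMeasure (μ p)
  pos : 0 < δ₀
  oneD : 1 ≤ D
  off : ∀ i j, ∀ h : i < j, SubG ((μ ⟨(i, j), h.le⟩).map (fun x => (√N : ℂ) * x)) δ₀ D
  var : ∀ i j, ∀ h : i < j, ∫ x, ‖x‖ ^ 2 ∂((μ ⟨(i, j), h.le⟩).map (fun x => (√N : ℂ) * x)) = 1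
  dg : ∀ i : Fin N, ∫⁻ x, ee (δ₀ * (√N * x.re) ^ 2) ∂(μ ⟨(i, i), le_refl i⟩) ≤ ENNReal.ofReal D

lemma SubG.conj {μ : Measure ℂ} {δ₀ D : ℝ} (h : SubG μ δ₀ D) : SubG (μ.map (starRingEnd ℂ)) δ₀ D := by
  have hm : Measurable (starRingEnd ℂ) := Complex.continuous_conj.measurable
  have := h.prob
  refine ⟨Measure.isProbabilityMeasure_map hm.aemeasurable, h.pos, ?_, ?_⟩
  · rw [integral_map hm.aemeasurable (by fun_prop), integral_conj, h.mean, map_zero]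
  · rw [lintegral_map (measurable_ee_comp (by fun_prop)) hm]
    simpa using h.bd

lemma SubG.zero {δ₀ D : ℝ} (h : 0 < δ₀) (hD : 1 ≤ D) : SubG (Measure.dirac 0) δ₀ D := by
  refine ⟨inferInstance, h, by simp, ?_⟩
  simp [ee]
  exact hD

def lam {N : ℕ} (μ : TT N → Measure ℂ) (i j : Fin N) : Measure ℂ :=
  (μ (sp i j)).map (fun y => (√N : ℂ) * phi i j y)

lemma lam_eq_lt {N : ℕ} (μ : TT N → Measure ℂ) {i j : Fin N} (h : j < i) :
    lam μ i j = (μ ⟨(j, i), h.le⟩).map (fun x => (√N : ℂ) * x) := by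
  simp [lam, sp, phi, h.not_ge, h.ne, h]

lemma lam_eq_gt {N : ℕ} (μ : TT N → Measure ℂ) {i j : Fin N} (h : i < j) :
    lam μ i j = ((μ ⟨(i, j), h.le⟩).map (fun x => (√N : ℂ) * x)).map (starRingEnd ℂ) := by
  rw [Measure.map_map Complex.continuous_conj.measurable (by fun_prop)]
  have h1 : (fun y : ℂ => (√N : ℂ) * phi i j y) = (starRingEnd ℂ) ∘ (fun x => (√N : ℂ) * x) := by
    ext y
    simp [phi, h.not_gt, h.ne']
  have h2 : sp i j = ⟨(i, j), h.le⟩ := by simp [sp, h.le]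
  rw [lam, h1, h2]

lemma lam_eq_self {N : ℕ} {μ : TT N → Measure ℂ} {δ₀ D : ℝ} (hM : Model N μ δ₀ D) (i : Fin N) :
    lam μ i i = Measure.dirac 0 := by
  have := hM.prob
  have h1 : (fun y : ℂ => (√N : ℂ) * phi i i y) = fun _ => 0 := by
    ext y
    simp [phi]
  rw [lam, h1, Measure.map_const]
  simp

lemma lam_subG {N : ℕ} {μ : TT N → Measure ℂ} {δ₀ D : ℝ} (hM : Model N μ δ₀ D) (i j : Fin N) :
    SubG (lam μ i j) δ₀ D := by
  rcases lt_trichotomy i j with h | h | h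
  · rw [lam_eq_gt μ h]; exact (hM.off i j h).conj
  · subst h; rw [lam_eq_self hM]; exact SubG.zero hM.pos hM.oneD
  · rw [lam_eq_lt μ h]; exact hM.off j i h

lemma lam_var {N : ℕ} {μ : TT N → Measure ℂ} {δ₀ D : ℝ} (hM : Model N μ δ₀ D) (i j : Fin N) :
    ∫ x, ‖x‖ ^ 2 ∂(lam μ i j) = if j = i then 0 else 1 := by
  rcases lt_trichotomy i j with h | h | h
  · rw [lam_eq_gt μ h, integral_map Complex.continuous_conj.measurable.aemeasurable (by fun_prop)]
    simp only [RCLike.norm_conj]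
    rw [hM.var i j h, if_neg h.ne']
  · subst h; rw [lam_eq_self hM]; simp
  · rw [lam_eq_lt μ h, hM.var j i h, if_neg h.ne]

lemma col_law {N : ℕ} {μ : TT N → Measure ℂ} {δ₀ D : ℝ} (hM : Model N μ δ₀ D) (i : Fin N)
    {F : (Fin N → ℂ) → ℝ≥0∞} (hF : Measurable F) :
    ∫⁻ x, F (fun j => (√N : ℂ) * colv i (Hm x) j) ∂(Measure.pi μ) = ∫⁻ u, F u ∂(Measure.pi (lam μ i)) := by
  have := hM.prob
  have hm : ∀ j, Measurable fun y => (√N : ℂ) * phi i j y := fun j => (phi_meas i j).const_mul _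
  have h1 : iIndepFun (fun (p : TT N) (x : TT N → ℂ) => x p) (Measure.pi μ) :=
    iIndepFun_pi (μ := μ) (X := fun _ y => y) (fun _ => aemeasurable_id)
  have h2 := (h1.precomp (sp_inj i)).comp (fun j y => (√N : ℂ) * phi i j y) hm
  have hmm : ∀ j, Measurable fun x : TT N → ℂ => (√N : ℂ) * phi i j (x (sp i j)) := fun j =>
    (hm j).comp (measurable_pi_apply _)
  have h3 := (iIndepFun_iff_map_fun_eq_pi_map (fun j => (hmm j).aemeasurable)).1 h2
  have h4 : (fun j => (Measure.pi μ).map (fun x : TT N → ℂ => (√N : ℂ) * phi i j (x (sp i j)))) = lam μ i := by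
    ext1 j
    have e := (measurePreserving_eval μ (sp i j)).map_eq
    rw [lam]
    conv_rhs => rw [← e]
    rw [Measure.map_map (hm j) (measurable_pi_apply _)]
    rfl
  rw [h4] at h3
  rw [← h3, lintegral_map hF (measurable_pi_lambda _ hmm)]
  simp only [colv_eq]

def mi {N : ℕ} (W : Matrix (Fin N) (Fin N) ℂ) (z : ℂ) : ℂ := (Matrix.trace (rsv W z) + 1 / z) / N

lemma qf_cqf {N : ℕ} (hN : 0 < N) {μ : TT N → Measure ℂ} {δ₀ D : ℝ} (hM : Model N μ δ₀ D) (i : Fin N)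
    {W : Matrix (Fin N) (Fin N) ℂ} {z : ℂ} (hR : rsv W z i i = -1 / z) (v : Fin N → ℂ) (c : ℝ) :
    cqf (lam μ i) (fun j k => (c : ℂ) * rsv W z j k) (fun j => (√N : ℂ) * v j) =
      (c * N : ℂ) * (qf (rsv W z) v - mi W z) := by
  have hN' : (N : ℂ) ≠ 0 := by exact_mod_cast hN.ne'
  refine (cqf_smul (lam μ i) (rsv W z) _ (c : ℂ)).trans ?_
  rw [mul_assoc]
  congr 1
  have hs : (√N : ℂ) * (√N : ℂ) = N := by
    rw [← Complex.ofReal_mul, Real.mul_self_sqrt (by positivity)]; simp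
  unfold cqf
  simp_rw [lam_var hM i]
  rw [mul_sub]
  congr 1
  · simp only [qf, dotProduct, Matrix.mulVec, Finset.mul_sum, Pi.star_apply, map_mul, Complex.conj_ofReal,
      RCLike.star_def]
    refine Finset.sum_congr rfl fun j _ => Finset.sum_congr rfl fun k _ => ?_
    rw [← hs]; ring
  · have : ∀ j, rsv W z j j * (((if j = i then 0 else 1 : ℝ)) : ℂ) = rsv W z j j - (if j = i then rsv W z j j else 0) := by
      intro j; split_ifs <;> simp
    rw [Finset.sum_congr rfl (fun j _ => this j), Finset.sum_sub_distrib, Finset.sum_ite_eq' Finset.univ i,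
      if_pos (Finset.mem_univ i), hR, mi, mul_div_cancel₀ _ hN', Matrix.trace]
    simp only [Matrix.diag]
    ring

lemma hs_mi {N : ℕ} (hN : 0 < N) {W : Matrix (Fin N) (Fin N) ℂ} (hW : W.IsHermitian) {z : ℂ} (hz : 0 < z.im)
    (hL : 1 ≤ N * z.im) (hm : ‖mi W z‖ ≤ 5 / 4) :
    ∑ j, ∑ k, ‖((√(N * z.im) / (2 * N) : ℝ) : ℂ) * rsv W z j k‖ ^ 2 ≤ 1 := by
  have hN' : (0 : ℝ) < N := by exact_mod_cast hN
  have hN'' : (N : ℂ) ≠ 0 := by exact_mod_cast hN.ne'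
  simp_rw [norm_mul, mul_pow, ← Finset.mul_sum]
  rw [rsv_hs hW hz, Complex.norm_real, Real.norm_of_nonneg (by positivity), div_pow, Real.sq_sqrt (by positivity)]
  have h1 : Matrix.trace (rsv W z) = N * mi W z - 1 / z := by
    rw [mi]; field_simp; ring
  have h2 : (Matrix.trace (rsv W z)).im ≤ N * (5 / 4) + 1 / z.im := by
    rw [h1, Complex.sub_im]
    have e1 : ((N : ℂ) * mi W z).im = N * (mi W z).im := by
      rw [← Complex.ofReal_natCast, Complex.im_ofReal_mul]
    have e2 : (mi W z).im ≤ 5 / 4 := (Complex.im_le_norm _).trans hm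
    have e3 : -(1 / z).im ≤ 1 / z.im := by
      have : |(1 / z).im| ≤ ‖1 / z‖ := Complex.abs_im_le_norm _
      rw [norm_div, norm_one] at this
      have e4 : 1 / ‖z‖ ≤ 1 / z.im := one_div_le_one_div_of_le hz (Complex.im_le_norm _)
      linarith [neg_abs_le (1 / z).im]
    rw [e1]
    nlinarith
  rw [div_mul_div_comm, div_le_one (by positivity)]
  have h3 : 1 / z.im ≤ N := by
    rw [div_le_iff₀ hz]; exact hL
  have h4 : (Matrix.trace (rsv W z)).im ≤ 4 * N := by linarith
  calc N * z.im * (Matrix.trace (rsv W z)).im ≤ N * z.im * (4 * N) := by gcongr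
    _ = _ := by ring

lemma cond_mgf (δ₀ D : ℝ) (hδ : 0 < δ₀) (hD : 1 ≤ D) : ∃ β C : ℝ, 0 < β ∧ 0 < C ∧
    ∀ (N : ℕ) (μ : TT N → Measure ℂ) (_ : Model N μ δ₀ D) (_ : 0 < N) (i : Fin N)
      (W : Matrix (Fin N) (Fin N) ℂ) (_ : W.IsHermitian) (z : ℂ) (_ : rsv W z i i = -1 / z)
      (_ : 0 < z.im) (_ : z.im ≤ 16) (_ : 1 ≤ N * z.im) (_ : ‖mi W z‖ ≤ 5 / 4),
      ∫⁻ x, ee (β * √(N * z.im) * ‖Hm x i i - (qf (rsv W z) (colv i (Hm x)) - mi W z)‖) ∂(Measure.pi μ)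
        ≤ ENNReal.ofReal C := by
  obtain ⟨θ, C, hθ, hC, hq⟩ := quad_form δ₀ D hδ hD
  refine ⟨θ / 4, C + Real.exp (4 * θ ^ 2 / δ₀) * D, by positivity, by positivity, ?_⟩
  intro N μ hM hN i W hW z hR hz hz16 hL hmi
  have := hM.prob
  have hN' : (0 : ℝ) < N := by exact_mod_cast hN
  set s := √(N * z.im) with hs
  have hs0 : 0 < s := Real.sqrt_pos.2 (by positivity)
  have hs1 : s ≤ 4 * √N := by
    rw [hs, Real.sqrt_le_left (by positivity), mul_pow, Real.sq_sqrt (by positivity)]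
    nlinarith
  set A : Fin N → Fin N → ℂ := fun j k => ((s / (2 * N) : ℝ) : ℂ) * rsv W z j k with hA
  have hAn : ∑ j, ∑ k, ‖A j k‖ ^ 2 ≤ 1 := hs_mi hN hW hz hL hmi
  have h1 := hq N (lam μ i) (lam_subG hM i) A hAn
  have hF : Measurable fun u => ee (θ * ‖cqf (lam μ i) A u‖) :=
    measurable_ee_comp ((cqf_meas _ _).norm.const_mul _)
  rw [← col_law hM i hF] at h1
  have h2 : ∀ x : TT N → ℂ, ‖cqf (lam μ i) A (fun j => (√N : ℂ) * colv i (Hm x) j)‖ =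
      s / 2 * ‖qf (rsv W z) (colv i (Hm x)) - mi W z‖ := by
    intro x
    rw [hA, qf_cqf hN hM i hR, norm_mul]
    congr 1
    rw [← Complex.ofReal_natCast, ← Complex.ofReal_mul, Complex.norm_real, Real.norm_of_nonneg (by positivity)]
    field_simp
  have h3 : ∀ x : TT N → ℂ, ee (θ / 4 * s * ‖Hm x i i - (qf (rsv W z) (colv i (Hm x)) - mi W z)‖) ≤
      ee (θ * ‖cqf (lam μ i) A (fun j => (√N : ℂ) * colv i (Hm x) j)‖) +
      ee (4 * θ ^ 2 / δ₀) * ee (δ₀ * (√N * (x ⟨(i, i), le_refl i⟩).re) ^ 2) := by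
    intro x
    rw [h2, ← ee_add]
    set a := ‖qf (rsv W z) (colv i (Hm x)) - mi W z‖
    have e1 : ‖Hm x i i - (qf (rsv W z) (colv i (Hm x)) - mi W z)‖ ≤ |(x ⟨(i, i), le_refl i⟩).re| + a := by
      refine (norm_sub_le _ _).trans ?_
      rw [Hm_diag, Complex.norm_real, Real.norm_eq_abs]
    set y := (x ⟨(i, i), le_refl i⟩).re
    refine le_trans (ee_mono ?_) (ee_half _ _)
    have e2 : θ / 2 * s * |y| ≤ 4 * θ ^ 2 / δ₀ + δ₀ * (√N * y) ^ 2 := by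
      have e3 : θ / 2 * s * |y| ≤ θ / 2 * (4 * √N) * |y| := by gcongr
      have e4 : (√N * y) ^ 2 = (√N * |y|) ^ 2 := by rw [mul_pow, mul_pow, sq_abs]
      rw [e4]
      have e5 : θ / 2 * (4 * √N) * |y| = 2 * θ * (√N * |y|) := by ring
      rw [e5] at e3
      generalize √N * |y| = q at *
      refine e3.trans ?_
      have e7 : 4 * θ ^ 2 / δ₀ + δ₀ * q ^ 2 - 2 * θ * q = ((θ - δ₀ * q) ^ 2 + 3 * θ ^ 2) / δ₀ := by
        field_simp; ring
      have : 0 ≤ ((θ - δ₀ * q) ^ 2 + 3 * θ ^ 2) / δ₀ := by positivity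
      linarith
    have e8 : θ / 4 * s * ‖Hm x i i - (qf (rsv W z) (colv i (Hm x)) - mi W z)‖ ≤ θ / 4 * s * (|y| + a) := by gcongr
    linarith
  refine (lintegral_mono h3).trans ?_
  have hm4 : Measurable fun x : TT N → ℂ => ee (δ₀ * (√N * (x ⟨(i, i), le_refl i⟩).re) ^ 2) :=
    measurable_ee_comp (by fun_prop)
  rw [lintegral_add_right _ (hm4.const_mul _), lintegral_const_mul _ hm4, ENNReal.ofReal_add hC.le (by positivity),
    ENNReal.ofReal_mul (Real.exp_pos _).le]
  refine add_le_add h1 ?_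
  change ee _ * _ ≤ ee _ * _
  gcongr
  have h5 := (measurePreserving_eval μ (⟨(i, i), le_refl i⟩ : TT N)).lintegral_comp
    (f := fun x : ℂ => ee (δ₀ * (√N * x.re) ^ 2)) (measurable_ee_comp (by fun_prop))
  exact h5.le.trans (hM.dg i)

lemma det_meas {α : Type*} [MeasurableSpace α] {N : ℕ} {M : α → Matrix (Fin N) (Fin N) ℂ}
    (hM : ∀ j k, Measurable fun x => M x j k) : Measurable fun x => (M x).det := by
  simp_rw [Matrix.det_apply']
  refine Finset.measurable_sum _ fun σ _ => ?_
  exact (Finset.measurable_prod _ fun i _ => hM _ _).const_mul _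

lemma rsv_meas {α : Type*} [MeasurableSpace α] {N : ℕ} {M : α → Matrix (Fin N) (Fin N) ℂ}
    (hM : ∀ j k, Measurable fun x => M x j k) (z : ℂ) (j k : Fin N) : Measurable fun x => rsv (M x) z j k := by
  unfold rsv
  have h1 : ∀ j k, Measurable fun x => (M x - z • (1 : Matrix (Fin N) (Fin N) ℂ)) j k := by
    intro j k
    simp only [Matrix.sub_apply]
    exact (hM j k).sub_const _
  simp_rw [Matrix.inv_def, Ring.inverse_eq_inv', Matrix.smul_apply, smul_eq_mul, Matrix.adjugate_apply]
  refine (det_meas h1).inv.mul (det_meas fun a b => ?_)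
  simp_rw [Matrix.updateRow_apply]
  split_ifs
  · fun_prop
  · exact h1 a b

lemma zrow_meas {α : Type*} [MeasurableSpace α] {N : ℕ} {M : α → Matrix (Fin N) (Fin N) ℂ}
    (hM : ∀ j k, Measurable fun x => M x j k) (i j k : Fin N) : Measurable fun x => zrow i (M x) j k := by
  unfold zrow
  split_ifs
  · fun_prop
  · exact hM j k

lemma colv_meas {α : Type*} [MeasurableSpace α] {N : ℕ} {M : α → Matrix (Fin N) (Fin N) ℂ}
    (hM : ∀ j k, Measurable fun x => M x j k) (i j : Fin N) : Measurable fun x => colv i (M x) j := by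
  unfold colv
  split_ifs
  · fun_prop
  · exact hM j i

lemma tr_meas {α : Type*} [MeasurableSpace α] {N : ℕ} {M : α → Matrix (Fin N) (Fin N) ℂ}
    (hM : ∀ j k, Measurable fun x => M x j k) (z : ℂ) : Measurable fun x => Matrix.trace (rsv (M x) z) := by
  unfold Matrix.trace
  exact Finset.measurable_sum _ fun i _ => rsv_meas hM z i i

lemma mi_meas {α : Type*} [MeasurableSpace α] {N : ℕ} {M : α → Matrix (Fin N) (Fin N) ℂ}
    (hM : ∀ j k, Measurable fun x => M x j k) (z : ℂ) : Measurable fun x => mi (M x) z :=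
  ((tr_meas hM z).add_const _).div_const _

lemma stTrans_meas {α : Type*} [MeasurableSpace α] {N : ℕ} {M : α → Matrix (Fin N) (Fin N) ℂ}
    (hM : ∀ j k, Measurable fun x => M x j k) (z : ℂ) : Measurable fun x => stTrans (M x) z :=
  (tr_meas hM z).div_const _

/-- the fluctuation variable -/
def Xv {N : ℕ} (i : Fin N) (A : Matrix (Fin N) (Fin N) ℂ) (z : ℂ) : ℂ :=
  A i i - (qf (rsv (zrow i A) z) (colv i A) - mi (zrow i A) z)

lemma Xv_meas {α : Type*} [MeasurableSpace α] {N : ℕ} {M : α → Matrix (Fin N) (Fin N) ℂ}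
    (hM : ∀ j k, Measurable fun x => M x j k) (i : Fin N) (z : ℂ) : Measurable fun x => Xv i (M x) z := by
  unfold Xv
  refine (hM i i).sub (Measurable.sub ?_ (mi_meas (zrow_meas hM i) z))
  unfold qf dotProduct Matrix.mulVec dotProduct
  refine Finset.measurable_sum _ fun j _ => Measurable.mul ?_ (Finset.measurable_sum _ fun k _ =>
    (rsv_meas (zrow_meas hM i) z j k).mul (colv_meas hM i k))
  exact Complex.continuous_conj.measurable.comp (colv_meas hM i j)

lemma pw {β L Nn : ℝ} (hβ : 0 < β) (hL : 1 ≤ L) (hN : 0 < Nn) (hlog : Real.log Nn ≤ β / 4 * √L) {X g b : ℂ}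
    (hg : g * (X - b) = 1) (hb : 3 / 4 ≤ ‖b‖) (hgN : ‖g‖ ≤ Nn) :
    (‖X‖ + 1 / L) * ‖g‖ ≤ 4 * (1 / β + 1) / √L * Real.exp (β * √L * ‖X‖) := by
  set s := √L with hs
  have hs1 : 1 ≤ s := Real.one_le_sqrt.2 hL
  have hs0 : 0 < s := by linarith
  have hsL : 1 / L ≤ 1 / s := by
    apply one_div_le_one_div_of_le hs0
    have : s * s = L := Real.mul_self_sqrt (by linarith)
    nlinarith
  set Y := β * s * ‖X‖ with hY
  have hY0 : 0 ≤ Y := by positivity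
  have h1 : ‖X‖ + 1 / L ≤ (1 / β + 1) / s * (Y + 1) := by
    have e1 : (1 / β + 1) / s * (Y + 1) = ‖X‖ + 1 / s + β * ‖X‖ + 1 / (β * s) := by
      rw [hY]; field_simp; ring
    have e2 : 0 ≤ β * ‖X‖ := by positivity
    have e3 : 0 ≤ 1 / (β * s) := by positivity
    linarith
  have h2 := Real.add_one_le_exp Y
  have hk : 0 < (1 / β + 1) / s := by positivity
  have hng : ‖g‖ * ‖X - b‖ = 1 := by rw [← norm_mul, hg, norm_one]
  have hnX : ‖b‖ - ‖X‖ ≤ ‖X - b‖ := by rw [norm_sub_rev]; exact norm_sub_norm_le _ _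
  rcases le_or_gt ‖X‖ (1 / 2) with h | h
  · have hg4 : ‖g‖ ≤ 4 := by nlinarith [norm_nonneg g]
    calc (‖X‖ + 1 / L) * ‖g‖ ≤ ((1 / β + 1) / s * Real.exp Y) * 4 := by
          gcongr
          exact h1.trans (by gcongr)
      _ = _ := by ring
  · have hgE : ‖g‖ ≤ Real.exp (Y / 2) := by
      refine hgN.trans ?_
      rw [← Real.exp_log hN]
      apply Real.exp_le_exp.2
      refine hlog.trans ?_
      rw [hY]
      have : β * s * (1 / 2) ≤ β * s * ‖X‖ := by gcongr
      linarith
    have h3 : Y + 1 ≤ 2 * Real.exp (Y / 2) := by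
      have := Real.add_one_le_exp (Y / 2); linarith
    calc (‖X‖ + 1 / L) * ‖g‖ ≤ ((1 / β + 1) / s * (2 * Real.exp (Y / 2))) * Real.exp (Y / 2) := by
          gcongr
          exact h1.trans (by gcongr)
      _ = 2 * ((1 / β + 1) / s) * Real.exp Y := by
          rw [show Real.exp Y = Real.exp (Y / 2) * Real.exp (Y / 2) by rw [← Real.exp_add]; ring_nf]; ring
      _ ≤ _ := by
          have : 0 < Real.exp Y := Real.exp_pos _
          have e : 4 * (1 / β + 1) / s = 4 * ((1 / β + 1) / s) := by ring
          rw [e]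
          gcongr
          norm_num

lemma diff_mi {N : ℕ} (hN : 0 < N) (i : Fin N) {A : Matrix (Fin N) (Fin N) ℂ} (hA : A.IsHermitian) {z : ℂ}
    (hz : 0 < z.im) : ‖stTrans A z - mi (zrow i A) z‖ ≤ 1 / (N * z.im) := by
  have hN' : (0 : ℝ) < N := by exact_mod_cast hN
  rw [stTrans_eq, mi, ← sub_div, norm_div, Complex.norm_natCast, div_le_iff₀ hN']
  refine (schur_full i hA hz).2.1.trans (le_of_eq ?_)
  field_simp

lemma det_step {N : ℕ} (hN : 0 < N) {A : Matrix (Fin N) (Fin N) ℂ} (hA : A.IsHermitian) {z : ℂ}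
    (hz : 0 < z.im) : ‖1 + z * stTrans A z + stTrans A z ^ 2‖ ≤
      ∑ i, 1 / (N : ℝ) * ((‖Xv i A z‖ + 1 / (N * z.im)) * ‖rsv A z i i‖) := by
  have hN' : (N : ℂ) ≠ 0 := by exact_mod_cast hN.ne'
  set m := stTrans A z with hm
  have h0 : m = ∑ i, 1 / (N : ℂ) * rsv A z i i := by
    rw [hm, stTrans_eq, Matrix.trace, ← Finset.mul_sum]
    simp only [Matrix.diag]
    field_simp
  have h1 : 1 + z * m + m ^ 2 = ∑ i, 1 / (N : ℂ) * (Xv i A z * rsv A z i i + (m - mi (zrow i A) z) * rsv A z i i) := by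
    have e1 : ∀ i, Xv i A z * rsv A z i i + (m - mi (zrow i A) z) * rsv A z i i = 1 + (z + m) * rsv A z i i := by
      intro i
      have := (schur_full i hA hz).1
      unfold Xv
      linear_combination this
    simp_rw [e1, mul_add, Finset.sum_add_distrib]
    have e2 : ∑ i : Fin N, 1 / (N : ℂ) * 1 = 1 := by simp [hN']
    have e3 : ∑ i, 1 / (N : ℂ) * ((z + m) * rsv A z i i) = (z + m) * m := by
      have e4 : (z + m) * m = (z + m) * ∑ i, 1 / (N : ℂ) * rsv A z i i := by rw [← h0]
      rw [e4, Finset.mul_sum]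
      refine Finset.sum_congr rfl fun i _ => by ring
    rw [e2, e3]; ring
  rw [h1]
  refine norm_sum_le_of_le _ fun i _ => ?_
  rw [norm_mul, norm_div, norm_one, Complex.norm_natCast]
  gcongr
  refine (norm_add_le _ _).trans ?_
  rw [norm_mul, norm_mul, add_mul]
  gcongr
  exact diff_mi hN i hA hz

def mix {N : ℕ} (i : Fin N) (u u' : TT N → ℂ) : TT N → ℂ :=
  fun p => if p.1.1 = i ∨ p.1.2 = i then u p else u' p

lemma mix_zrow {N : ℕ} (i : Fin N) (u u' : TT N → ℂ) : zrow i (Hm (mix i u u')) = zrow i (Hm u') := by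
  ext j k
  simp only [zrow, Hm, mix]
  by_cases h : j = i ∨ k = i
  · simp [h]
  · push Not at h
    simp [h.1, h.2]

lemma mix_colv {N : ℕ} (i : Fin N) (u u' : TT N → ℂ) : colv i (Hm (mix i u u')) = colv i (Hm u) := by
  ext j
  simp only [colv, Hm, mix]
  simp

lemma mix_diag {N : ℕ} (i : Fin N) (u u' : TT N → ℂ) : Hm (mix i u u') i i = Hm u i i := by
  simp [Hm, mix]

lemma add_mSC {z : ℂ} (hz : 0 < z.im) : 1 ≤ ‖z + mSC z‖ := by
  obtain ⟨h1, h2, h3, _⟩ := mSC_facts hz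
  have h4 : mSC z * (z + mSC z) = -1 := by linear_combination h1
  have h5 : ‖mSC z‖ * ‖z + mSC z‖ = 1 := by rw [← norm_mul, h4]; simp
  nlinarith [norm_nonneg (mSC z), norm_nonneg (z + mSC z)]

def Lam {N : ℕ} (z : ℂ) (x : TT N → ℂ) : ℝ := ‖stTrans (Hm x) z - mSC z‖

lemma Lam_meas {N : ℕ} (z : ℂ) : Measurable (Lam (N := N) z) :=
  ((stTrans_meas Hm_meas z).sub_const _).norm

def Lami {N : ℕ} (i : Fin N) (z : ℂ) (x : TT N → ℂ) : ℝ := ‖mi (zrow i (Hm x)) z - mSC z‖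

lemma Lami_meas {N : ℕ} (i : Fin N) (z : ℂ) : Measurable (Lami i z) :=
  ((mi_meas (zrow_meas Hm_meas i) z).sub_const _).norm

lemma Lami_close {N : ℕ} (hN : 0 < N) (i : Fin N) {z : ℂ} (hz : 0 < z.im) (x : TT N → ℂ) :
    |Lam z x - Lami i z x| ≤ 1 / (N * z.im) := by
  refine (abs_norm_sub_norm_le _ _).trans ?_
  rw [sub_sub_sub_cancel_right]
  exact diff_mi hN i (Hm_herm x) hz

def Gi {N : ℕ} (i : Fin N) (z : ℂ) (x : TT N → ℂ) : ℝ :=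
  (‖Xv i (Hm x) z‖ + 1 / (N * z.im)) * ‖rsv (Hm x) z i i‖

lemma Gi_meas {N : ℕ} (i : Fin N) (z : ℂ) : Measurable (Gi i z) :=
  ((Xv_meas Hm_meas i z).norm.add_const _).mul (rsv_meas Hm_meas z i i).norm

lemma Gi_nonneg {N : ℕ} (i : Fin N) {z : ℂ} (hz : 0 < z.im) (x : TT N → ℂ) : 0 ≤ Gi i z x := by
  unfold Gi; positivity

lemma cond_G (δ₀ D : ℝ) (hδ : 0 < δ₀) (hD : 1 ≤ D) : ∃ β C : ℝ, 0 < β ∧ 0 < C ∧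
    ∀ (N : ℕ) (μ : TT N → Measure ℂ) (_ : Model N μ δ₀ D) (_ : 0 < N) (i : Fin N) (z : ℂ)
      (_ : 0 < z.im) (_ : z.im ≤ 16) (_ : 1 ≤ N * z.im) (_ : Real.log N ≤ β / 4 * √(N * z.im))
      (u' : TT N → ℂ) (_ : Lami i z u' ≤ 1 / 4),
      ∫⁻ u, ENNReal.ofReal (Gi i z (mix i u u')) ∂(Measure.pi μ) ≤ ENNReal.ofReal (C / √(N * z.im)) := by
  obtain ⟨β, C, hβ, hC, h⟩ := cond_mgf δ₀ D hδ hD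
  refine ⟨β, 4 * (1 / β + 1) * C, hβ, by positivity, ?_⟩
  intro N μ hM hN i z hz hz16 hL hlog u' hu'
  have hN' : (0 : ℝ) < N := by exact_mod_cast hN
  have hW := zrow_herm i (Hm_herm u')
  have hR := (schur_full i (Hm_herm u') hz).2.2
  have hm : ‖mi (zrow i (Hm u')) z‖ ≤ 5 / 4 := by
    have h1 : ‖mi (zrow i (Hm u')) z‖ ≤ Lami i z u' + ‖mSC z‖ := by
      have := norm_add_le (mi (zrow i (Hm u')) z - mSC z) (mSC z)
      simpa [Lami] using this
    linarith [(mSC_facts hz).2.1]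
  have hb : 3 / 4 ≤ ‖z + mi (zrow i (Hm u')) z‖ := by
    have h1 : ‖z + mSC z‖ ≤ ‖z + mi (zrow i (Hm u')) z‖ + Lami i z u' := by
      have := norm_sub_le (z + mi (zrow i (Hm u')) z) (mi (zrow i (Hm u')) z - mSC z)
      have e : z + mi (zrow i (Hm u')) z - (mi (zrow i (Hm u')) z - mSC z) = z + mSC z := by ring
      rwa [e] at this
    linarith [add_mSC hz]
  have h1 := h N μ hM hN i _ hW z hR hz hz16 hL hm
  set s := √(N * z.im) with hs
  have h2 : ∀ u, ENNReal.ofReal (Gi i z (mix i u u')) ≤ ENNReal.ofReal (4 * (1 / β + 1) / s) *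
      ee (β * s * ‖Hm u i i - (qf (rsv (zrow i (Hm u')) z) (colv i (Hm u)) - mi (zrow i (Hm u')) z)‖) := by
    intro u
    rw [ee, ← ENNReal.ofReal_mul (by positivity)]
    apply ENNReal.ofReal_le_ofReal
    have hX : Xv i (Hm (mix i u u')) z = Hm u i i - (qf (rsv (zrow i (Hm u')) z) (colv i (Hm u)) - mi (zrow i (Hm u')) z) := by
      rw [Xv, mix_zrow, mix_colv, mix_diag]
    rw [Gi, ← hX]
    refine pw hβ hL hN' hlog ?_ hb ?_
    · have := (schur_full i (Hm_herm (mix i u u')) hz).1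
      rw [mix_zrow] at this
      rw [Xv, mix_zrow]
      linear_combination this
    · refine (rsv_diag_le (Hm_herm _) hz i).trans ?_
      rw [div_le_iff₀ hz]; exact hL
  refine (lintegral_mono h2).trans ?_
  rw [lintegral_const_mul' _ _ ENNReal.ofReal_ne_top]
  calc _ ≤ ENNReal.ofReal (4 * (1 / β + 1) / s) * ENNReal.ofReal C := by gcongr
    _ = _ := by
      rw [← ENNReal.ofReal_mul (by positivity)]
      congr 1; ring

lemma one_step (δ₀ D : ℝ) (hδ : 0 < δ₀) (hD : 1 ≤ D) : ∃ β C : ℝ, 0 < β ∧ 0 < C ∧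
    ∀ (N : ℕ) (μ : TT N → Measure ℂ) (_ : Model N μ δ₀ D) (_ : 0 < N) (z : ℂ)
      (_ : 0 < z.im) (_ : z.im ≤ 16) (_ : 1 ≤ N * z.im) (_ : Real.log N ≤ β / 4 * √(N * z.im))
      (c a e : ℝ) (_ : 0 < c) (_ : c ≤ (mSC z).im) (_ : 0 ≤ a) (_ : e + 1 / (N * z.im) ≤ 1 / 4),
      ENNReal.ofReal (c * a) * (Measure.pi μ) {x | a ≤ Lam z x ∧ Lam z x ≤ e} ≤
        ENNReal.ofReal (C / √(N * z.im)) *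
          (Measure.pi μ) {x | a - 2 / (N * z.im) ≤ Lam z x ∧ Lam z x ≤ e + 2 / (N * z.im)} := by
  obtain ⟨β, C, hβ, hC, h⟩ := cond_G δ₀ D hδ hD
  refine ⟨β, C, hβ, hC, ?_⟩
  intro N μ hM hN z hz hz16 hL hlog c a e hc hcz ha he
  have := hM.prob
  have hN' : (0 : ℝ) < N := by exact_mod_cast hN
  set ℓ := 1 / (N * z.im) with hℓ
  have hℓ2 : 2 / (N * z.im) = 2 * ℓ := by rw [hℓ]; ring
  rw [hℓ2]
  set B : Fin N → Set (TT N → ℂ) := fun i => {x | a - ℓ ≤ Lami i z x ∧ Lami i z x ≤ e + ℓ} with hB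
  have hBm : ∀ i, MeasurableSet (B i) := fun i =>
    (measurableSet_le measurable_const (Lami_meas i z)).inter (measurableSet_le (Lami_meas i z) measurable_const)
  set S : Set (TT N → ℂ) := {x | a ≤ Lam z x ∧ Lam z x ≤ e} with hS
  have hSm : MeasurableSet S :=
    (measurableSet_le measurable_const (Lam_meas z)).inter (measurableSet_le (Lam_meas z) measurable_const)
  set T : Set (TT N → ℂ) := {x | a - 2 * ℓ ≤ Lam z x ∧ Lam z x ≤ e + 2 * ℓ} with hT
  have hcl := fun i x => abs_le.1 (Lami_close hN i hz x)
  have hSB : ∀ i, S ⊆ B i := by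
    intro i x hx
    have := hcl i x
    exact ⟨by linarith [hx.1], by linarith [hx.2]⟩
  have hBT : ∀ i, B i ⊆ T := by
    intro i x hx
    have := hcl i x
    exact ⟨by linarith [hx.1], by linarith [hx.2]⟩
  have hFm : ∀ i, Measurable fun x => ENNReal.ofReal (Gi i z x) * (B i).indicator 1 x := fun i =>
    (Gi_meas i z).ennreal_ofReal.mul (measurable_one.indicator (hBm i))
  have h1 : ∀ x, ENNReal.ofReal (c * a) * S.indicator 1 x ≤
      ∑ i, ENNReal.ofReal (1 / N) * (ENNReal.ofReal (Gi i z x) * (B i).indicator 1 x) := by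
    intro x
    by_cases hx : x ∈ S
    · simp only [Set.indicator_of_mem hx, Set.indicator_of_mem (hSB _ hx), Pi.one_apply, mul_one]
      simp_rw [← ENNReal.ofReal_mul (by positivity : (0 : ℝ) ≤ 1 / N)]
      rw [← ENNReal.ofReal_sum_of_nonneg (fun i _ => mul_nonneg (by positivity) (Gi_nonneg i hz x))]
      apply ENNReal.ofReal_le_ofReal
      calc c * a ≤ (mSC z).im * Lam z x := by
            apply mul_le_mul hcz hx.1 ha (by linarith)
        _ ≤ _ := stab hz (stTrans_im_nonneg (Hm_herm x) hz)
        _ ≤ _ := det_step hN (Hm_herm x) hz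
    · simp [hx]
  have h2 : ENNReal.ofReal (c * a) * (Measure.pi μ) S = ∫⁻ x, ENNReal.ofReal (c * a) * S.indicator 1 x ∂(Measure.pi μ) := by
    rw [lintegral_const_mul _ (measurable_one.indicator hSm), lintegral_indicator_one hSm]
  rw [h2]
  refine (lintegral_mono h1).trans ?_
  rw [lintegral_finsetSum _ (fun i _ => (hFm i).const_mul _)]
  have h3 : ∀ i, ∫⁻ x, ENNReal.ofReal (1 / N) * (ENNReal.ofReal (Gi i z x) * (B i).indicator 1 x) ∂(Measure.pi μ) ≤
      ENNReal.ofReal (1 / N) * (ENNReal.ofReal (C / √(N * z.im)) * (Measure.pi μ) T) := by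
    intro i
    rw [lintegral_const_mul _ (hFm i)]
    gcongr
    rw [resample μ (fun p => p.1.1 = i ∨ p.1.2 = i) (hFm i)]
    change ∫⁻ u', ∫⁻ u, ENNReal.ofReal (Gi i z (mix i u u')) * (B i).indicator 1 (mix i u u') ∂_ ∂_ ≤ _
    calc _ ≤ ∫⁻ u', ENNReal.ofReal (C / √(N * z.im)) * (B i).indicator 1 u' ∂(Measure.pi μ) := by
          apply lintegral_mono
          intro u'
          have hmix : ∀ u, mix i u u' ∈ B i ↔ u' ∈ B i := by
            intro u
            simp only [hB, Set.mem_ofPred_eq, Lami, mix_zrow]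
          by_cases hu : u' ∈ B i
          · simp only [Set.indicator_of_mem hu, Set.indicator_of_mem ((hmix _).2 hu), Pi.one_apply, mul_one]
            exact h N μ hM hN i z hz hz16 hL hlog u' (hu.2.trans he)
          · have : ∀ u, mix i u u' ∉ B i := fun u hc => hu ((hmix u).1 hc)
            simp [hu, this]
      _ = ENNReal.ofReal (C / √(N * z.im)) * (Measure.pi μ) (B i) := by
          rw [lintegral_const_mul _ (measurable_one.indicator (hBm i)), lintegral_indicator_one (hBm i)]
      _ ≤ _ := by gcongr; exact hBT i
  refine (Finset.sum_le_sum fun i _ => h3 i).trans (le_of_eq ?_)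
  rw [← Finset.sum_mul, ← ENNReal.ofReal_sum_of_nonneg (fun i _ => by positivity)]
  simp [hN'.ne']

lemma log_small {t x s : ℝ} (ht : 0 < t) (hs0 : 0 < s) (hx : x ^ 2 ≤ s) (hs : 1 / t ^ 2 ≤ s) : x ≤ t * s := by
  by_contra hc
  push Not at hc
  have h1 : (t * s) ^ 2 < x ^ 2 := by gcongr
  rw [div_le_iff₀ (by positivity)] at hs
  nlinarith

lemma gap (κ δ₀ D : ℝ) (hκ : 0 < κ) (hκ2 : κ ≤ 2) (hδ : 0 < δ₀) (hD : 1 ≤ D) : ∃ M L₀ : ℝ, 1 ≤ M ∧ 1 ≤ L₀ ∧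
    ∀ (N : ℕ) (μ : TT N → Measure ℂ) (_ : Model N μ δ₀ D) (_ : 0 < N) (E η : ℝ) (_ : |E| ≤ 2 - κ)
      (_ : 0 < η) (_ : η ≤ 16) (_ : L₀ ≤ N * η) (_ : Real.log N ^ 2 ≤ √(N * η)),
      (Measure.pi μ) {x | 2 * M / √(N * η) ≤ Lam ((E : ℂ) + η * Complex.I) x ∧
        Lam ((E : ℂ) + η * Complex.I) x ≤ 1 / 8} ≤ ENNReal.ofReal (Real.exp (1 - √(N * η) / 32)) := by
  obtain ⟨c, hc, hcm⟩ := mSC_im_lower hκ hκ2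
  obtain ⟨β, C, hβ, hC, h⟩ := one_step δ₀ D hδ hD
  refine ⟨max 1 (Real.exp 1 * C / c), max 1 ((16 / β ^ 2) ^ 2), le_max_left _ _, le_max_left _ _, ?_⟩
  intro N μ hM hN E η hE hη hη16 hL hlog
  set M := max 1 (Real.exp 1 * C / c) with hMd
  have hM1 : 1 ≤ M := le_max_left _ _
  have hMc : Real.exp 1 * C ≤ c * M := by
    have := le_max_right 1 (Real.exp 1 * C / c)
    rw [← hMd, div_le_iff₀ hc] at this
    linarith
  have := hM.prob
  have hN' : (0 : ℝ) < N := by exact_mod_cast hN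
  have hL1 : 1 ≤ N * η := (le_max_left _ _).trans hL
  set z : ℂ := (E : ℂ) + η * Complex.I with hz
  have hzim : z.im = η := by simp [hz]
  set L := N * η with hLd
  set s := √L with hs
  have hs1 : 1 ≤ s := Real.one_le_sqrt.2 hL1
  have hs0 : 0 < s := by linarith
  have hss : s * s = L := Real.mul_self_sqrt (by linarith)
  have hsβ : 16 / β ^ 2 ≤ s := Real.le_sqrt_of_sq_le ((le_max_right _ _).trans hL)
  have hlog2 : Real.log N ≤ β / 4 * s := by
    apply log_small (by positivity) hs0 hlog
    rw [div_pow, one_div_div]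
    linarith
  have hcz : c ≤ (mSC z).im := hcm E η hE hη hη16
  have key : ∀ n : ℕ, ∀ a e : ℝ, M / s + 2 * n / L ≤ a → e + 2 * n / L ≤ 1 / 4 →
      (Measure.pi μ) {x | a ≤ Lam z x ∧ Lam z x ≤ e} ≤ ENNReal.ofReal (Real.exp (-n)) := by
    intro n
    induction n with
    | zero =>
      intro a e _ _
      simpa using prob_le_one
    | succ n ih =>
      intro a e ha he
      push_cast at ha he
      have hn0 : 0 ≤ 2 * (n : ℝ) / L := by positivity
      have hl0 : 0 < 1 / L := by positivity
      have e1 : 2 * ((n : ℝ) + 1) / L = 2 * n / L + 2 * (1 / L) := by ring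
      rw [e1] at ha he
      have e2 : 2 / L = 2 * (1 / L) := by ring
      have ha0 : M / s ≤ a := by linarith
      have ha1 : 0 ≤ a := le_trans (by positivity) ha0
      have h1 := h N μ hM hN z (by rw [hzim]; exact hη) (by rw [hzim]; exact hη16) (by rw [hzim]; exact hL1)
        (by rw [hzim]; exact hlog2) c a e hc hcz ha1 (by rw [hzim]; linarith)
      rw [hzim] at h1
      have h2 := ih (a - 2 / L) (e + 2 / L) (by linarith) (by linarith)
      have h3 : ENNReal.ofReal (Real.exp 1 * (C / s)) ≤ ENNReal.ofReal (c * a) := by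
        apply ENNReal.ofReal_le_ofReal
        calc Real.exp 1 * (C / s) = (Real.exp 1 * C) / s := by ring
          _ ≤ c * M / s := by gcongr
          _ = c * (M / s) := by ring
          _ ≤ _ := by gcongr
      have hCs : 0 < C / s := by positivity
      have h4 : ENNReal.ofReal (Real.exp 1 * (C / s)) * (Measure.pi μ) {x | a ≤ Lam z x ∧ Lam z x ≤ e} ≤
          ENNReal.ofReal (Real.exp 1 * (C / s)) * ENNReal.ofReal (Real.exp (-(n + 1 : ℕ))) := by
        calc _ ≤ _ := mul_le_mul_left h3 _
          _ ≤ _ := h1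
          _ ≤ ENNReal.ofReal (C / s) * ENNReal.ofReal (Real.exp (-n)) := by gcongr
          _ = _ := by
            rw [← ENNReal.ofReal_mul hCs.le, ← ENNReal.ofReal_mul (by positivity)]
            congr 1
            rw [show -(n : ℝ) = 1 + -((n + 1 : ℕ) : ℝ) by push_cast; ring, Real.exp_add]
            ring
      have h5 : ENNReal.ofReal (Real.exp 1 * (C / s)) ≠ 0 := by
        simp only [ne_eq, ENNReal.ofReal_eq_zero, not_le]; positivity
      exact (ENNReal.mul_le_mul_iff_right h5 ENNReal.ofReal_ne_top).1 h4
  set n := ⌊s / 32⌋₊ with hn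
  have hn1 : (n : ℝ) ≤ s / 32 := Nat.floor_le (by positivity)
  have hn2 : s / 32 < n + 1 := Nat.lt_floor_add_one _
  have hn3 : 2 * (n : ℝ) / L ≤ 1 / (16 * s) := by
    rw [← hss, div_le_div_iff₀ (by positivity) (by positivity)]
    nlinarith
  have hn4 : 1 / (16 * s) ≤ M / s := by
    rw [div_le_div_iff₀ (by positivity) (by positivity)]
    nlinarith
  have hn5 : 1 / (16 * s) ≤ 1 / 16 := by
    apply one_div_le_one_div_of_le <;> nlinarith
  refine (key n (2 * M / s) (1 / 8) ?_ (by linarith)).trans ?_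
  · have : 2 * M / s = M / s + M / s := by ring
    linarith
  · apply ENNReal.ofReal_le_ofReal
    apply Real.exp_le_exp.2
    linarith

def zz (E η : ℝ) : ℂ := (E : ℂ) + η * Complex.I

lemma zz_im (E η : ℝ) : (zz E η).im = η := by simp [zz]

lemma zz_sub (E E' η η' : ℝ) : ‖zz E η - zz E' η'‖ ≤ |E - E'| + |η - η'| := by
  have h : zz E η - zz E' η' = ((E - E' : ℝ) : ℂ) + ((η - η' : ℝ) : ℂ) * Complex.I := by
    simp only [zz]; push_cast; ring
  rw [h]
  refine (norm_add_le _ _).trans ?_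
  rw [norm_mul, Complex.norm_I, mul_one, Complex.norm_real, Complex.norm_real, Real.norm_eq_abs, Real.norm_eq_abs]

def etak (N : ℕ) (η : ℝ) (k : ℕ) : ℝ := 16 - (16 - η) * k / (N : ℝ) ^ 3

def Ej (N : ℕ) (κ : ℝ) (j : ℕ) : ℝ := min (-2 + κ + 4 * j / (N : ℝ) ^ 3) (2 - κ)

lemma Lam_lip {N : ℕ} (hN : 0 < N) {η : ℝ} (hη : 0 < η) (hη1 : η ≤ 1) (hL : 1 ≤ N * η) (x : TT N → ℂ)
    {E E' η₁ η₂ : ℝ} (h1 : η ≤ η₁) (h2 : η ≤ η₂) :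
    Lam (zz E η₁) x ≤ Lam (zz E' η₂) x + (|E - E'| + |η₁ - η₂|) * (2 * N ^ 2) := by
  have hN' : (0 : ℝ) < N := by exact_mod_cast hN
  set d := |E - E'| + |η₁ - η₂| with hd
  have hd0 : 0 ≤ d := by positivity
  have hi : 1 / η ≤ N := by rw [div_le_iff₀ hη]; exact hL
  have hN1 : (1 : ℝ) ≤ N := by exact_mod_cast hN
  have e1 := stTrans_lip hN (Hm_herm x) (z := zz E η₁) (w := zz E' η₂) (by rw [zz_im]; linarith) (by rw [zz_im]; linarith)
  have e2 := mSC_lip (z := zz E η₁) (w := zz E' η₂) hη (by rw [zz_im]; linarith) (by rw [zz_im]; linarith)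
  have e3 := zz_sub E E' η₁ η₂
  rw [zz_im, zz_im] at e1
  have e4 : ‖zz E η₁ - zz E' η₂‖ / (η₁ * η₂) ≤ d * N ^ 2 := by
    calc _ ≤ d / (η * η) := by
          have : 0 ≤ η₁ := by linarith
          gcongr
      _ = d * (1 / η) ^ 2 := by field_simp
      _ ≤ _ := by gcongr
  have e5 : ‖zz E η₁ - zz E' η₂‖ / η ≤ d * N ^ 2 := by
    calc _ ≤ d / η := by gcongr
      _ = d * (1 / η) := by ring
      _ ≤ d * N := by gcongr
      _ ≤ _ := by gcongr; nlinarith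
  have e6 : Lam (zz E η₁) x ≤ Lam (zz E' η₂) x + (‖stTrans (Hm x) (zz E η₁) - stTrans (Hm x) (zz E' η₂)‖ +
      ‖mSC (zz E η₁) - mSC (zz E' η₂)‖) := by
    unfold Lam
    have : stTrans (Hm x) (zz E η₁) - mSC (zz E η₁) = (stTrans (Hm x) (zz E' η₂) - mSC (zz E' η₂)) +
      ((stTrans (Hm x) (zz E η₁) - stTrans (Hm x) (zz E' η₂)) - (mSC (zz E η₁) - mSC (zz E' η₂))) := by ring
    rw [this]
    refine (norm_add_le _ _).trans ?_
    gcongr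
    exact norm_sub_le _ _
  linarith

lemma bootstrap {N : ℕ} (hN : 0 < N) {κ η M : ℝ} (hκ : 0 < κ) (hκ2 : κ ≤ 2) (hη : 0 < η) (hη1 : η ≤ 1) (hM : 1 ≤ M)
    (hL : 512 ≤ N * η) (hLM : 32 * M ≤ √(N * η)) (x : TT N → ℂ)
    (hgood : ∀ k j : ℕ, k ≤ N ^ 3 → j ≤ N ^ 3 → ¬ (2 * M / √(N * etak N η k) ≤ Lam (zz (Ej N κ j) (etak N η k)) x ∧
      Lam (zz (Ej N κ j) (etak N η k)) x ≤ 1 / 8)) (E : ℝ) (hE : E ∈ Set.Icc (-2 + κ) (2 - κ)) :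
    Lam (zz E η) x ≤ (2 * M + 8) / √(N * η) := by
  have hN' : (0 : ℝ) < N := by exact_mod_cast hN
  have hN3 : (0 : ℝ) < (N : ℝ) ^ 3 := by positivity
  have hL1 : 1 ≤ N * η := by linarith
  set s := √(N * η) with hs
  have hs1 : 1 ≤ s := Real.one_le_sqrt.2 hL1
  have hs0 : 0 < s := by linarith
  have hss : s * s = N * η := Real.mul_self_sqrt (by linarith)
  have hNL : N * η ≤ N := by nlinarith
  have hsN : s ≤ N := by nlinarith
  have hek : ∀ k : ℕ, k ≤ N ^ 3 → η ≤ etak N η k ∧ etak N η k ≤ 16 := by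
    intro k hk
    have hk' : (k : ℝ) ≤ (N : ℝ) ^ 3 := by exact_mod_cast hk
    unfold etak
    have e1 : (16 - η) * k / (N : ℝ) ^ 3 ≤ 16 - η := by
      rw [div_le_iff₀ hN3]
      exact mul_le_mul_of_nonneg_left hk' (by linarith)
    have e2 : 0 ≤ (16 - η) * k / (N : ℝ) ^ 3 := div_nonneg (mul_nonneg (by linarith) (by positivity)) hN3.le
    constructor <;> linarith
  have hthr : ∀ k : ℕ, k ≤ N ^ 3 → 2 * M / √(N * etak N η k) ≤ 2 * M / s := by
    intro k hk
    have := (hek k hk).1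
    have h2 : s ≤ √(N * etak N η k) := Real.sqrt_le_sqrt (by gcongr)
    gcongr
  have hthr2 : 2 * M / s ≤ 1 / 16 := by
    rw [div_le_div_iff₀ hs0 (by norm_num)]; linarith
  have key : ∀ k : ℕ, k ≤ N ^ 3 → ∀ j : ℕ, j ≤ N ^ 3 → Lam (zz (Ej N κ j) (etak N η k)) x < 2 * M / s := by
    intro k
    induction k with
    | zero =>
      intro hk j hj
      have hb : Lam (zz (Ej N κ j) (etak N η 0)) x ≤ 1 / 8 := by
        have e0 : etak N η 0 = 16 := by simp [etak]
        rw [e0]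
        have e1 := stTrans_norm_le (Hm_herm x) (z := zz (Ej N κ j) 16) (by rw [zz_im]; norm_num)
        have e2 := mSC_norm_le (z := zz (Ej N κ j) 16) (by rw [zz_im]; norm_num)
        rw [zz_im] at e1 e2
        refine (norm_sub_le _ _).trans ?_
        linarith
      have := hgood 0 j hk hj
      by_contra hc
      push Not at hc
      exact this ⟨(hthr 0 hk).trans hc, hb⟩
    | succ k ih =>
      intro hk j hj
      have hk' : k ≤ N ^ 3 := by omega
      have e1 := ih hk' j hj
      have e2 := Lam_lip hN hη hη1 hL1 x (E := Ej N κ j) (E' := Ej N κ j) (hek (k + 1) hk).1 (hek k hk').1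
      have e3 : |etak N η (k + 1) - etak N η k| ≤ 16 / (N : ℝ) ^ 3 := by
        have : etak N η (k + 1) - etak N η k = - ((16 - η) / (N : ℝ) ^ 3) := by
          unfold etak; push_cast; ring
        rw [this, abs_neg, abs_of_nonneg (div_nonneg (by linarith) hN3.le)]
        gcongr; linarith
      have e4 : (|Ej N κ j - Ej N κ j| + |etak N η (k + 1) - etak N η k|) * (2 * N ^ 2) ≤ 1 / 16 := by
        rw [sub_self, abs_zero, zero_add]
        calc _ ≤ 16 / (N : ℝ) ^ 3 * (2 * N ^ 2) := by gcongr
          _ = 32 / N := by field_simp; norm_num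
          _ ≤ _ := by rw [div_le_div_iff₀ hN' (by norm_num)]; linarith
      have := hgood (k + 1) j hk hj
      by_contra hc
      push Not at hc
      exact this ⟨(hthr (k + 1) hk).trans hc, by linarith⟩
  -- final
  have hlast : etak N η (N ^ 3) = η := by
    unfold etak; push_cast; field_simp; ring
  set j := ⌊(E + 2 - κ) * (N : ℝ) ^ 3 / 4⌋₊ with hj
  have hE0 : 0 ≤ E + 2 - κ := by linarith [hE.1]
  have hj1 : (j : ℝ) ≤ (E + 2 - κ) * (N : ℝ) ^ 3 / 4 := Nat.floor_le (by positivity)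
  have hj2 : (E + 2 - κ) * (N : ℝ) ^ 3 / 4 < j + 1 := Nat.lt_floor_add_one _
  have hjN : j ≤ N ^ 3 := by
    have : (j : ℝ) ≤ (N : ℝ) ^ 3 := by nlinarith [hE.2]
    exact_mod_cast this
  have hj3 : 4 * (j : ℝ) / (N : ℝ) ^ 3 ≤ E + 2 - κ := by rw [div_le_iff₀ hN3]; linarith
  have hj4 : E + 2 - κ ≤ 4 * (j : ℝ) / (N : ℝ) ^ 3 + 4 / (N : ℝ) ^ 3 := by
    rw [← add_div, le_div_iff₀ hN3]; linarith
  have hEj : Ej N κ j = -2 + κ + 4 * j / (N : ℝ) ^ 3 := min_eq_left (by linarith [hE.2])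
  have e1 := key (N ^ 3) le_rfl j hjN
  rw [hlast] at e1
  have e2 := Lam_lip hN hη hη1 hL1 x (E := E) (E' := Ej N κ j) le_rfl le_rfl
  have e3 : (|E - Ej N κ j| + |η - η|) * (2 * N ^ 2) ≤ 8 / s := by
    rw [sub_self, abs_zero, add_zero, hEj, abs_of_nonneg (by linarith)]
    calc _ ≤ 4 / (N : ℝ) ^ 3 * (2 * N ^ 2) := by gcongr; linarith
      _ = 8 / N := by field_simp; norm_num
      _ ≤ _ := by gcongr
  rw [add_div]
  linarith

lemma Ej_abs {κ : ℝ} (hκ2 : κ ≤ 2) (N j : ℕ) : |Ej N κ j| ≤ 2 - κ := by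
  rw [abs_le]
  have h : (0 : ℝ) ≤ 4 * j / (N : ℝ) ^ 3 := by positivity
  exact ⟨le_min (by linarith) (by linarith), min_le_right _ _⟩

lemma model_bound (κ δ₀ D : ℝ) (hκ : 0 < κ) (hκ2 : κ ≤ 2) (hδ : 0 < δ₀) (hD : 1 ≤ D) : ∃ M L₀ : ℝ, 0 < M ∧ 1 ≤ L₀ ∧
    ∀ (N : ℕ) (μ : TT N → Measure ℂ) (_ : Model N μ δ₀ D) (_ : 0 < N) (η : ℝ)
      (_ : 0 < η) (_ : η ≤ 1) (_ : L₀ ≤ N * η) (_ : Real.log N ^ 4 ≤ N * η),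
      ∃ Bad : Set (TT N → ℂ), MeasurableSet Bad ∧
      (Measure.pi μ) Bad ≤ ENNReal.ofReal (4 * Real.exp 1 * Real.exp (-(√(N * η) / 64))) ∧
      ∀ x, x ∉ Bad → ∀ E ∈ Set.Icc (-2 + κ) (2 - κ), Lam (zz E η) x ≤ M / √(N * η) := by
  obtain ⟨M, L₀, hM, hL₀, h⟩ := gap κ δ₀ D hκ hκ2 hδ hD
  refine ⟨2 * M + 8, max L₀ (max 512 (max ((32 * M) ^ 2) ((384 ^ 2) ^ 2))), by linarith, hL₀.trans (le_max_left _ _), ?_⟩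
  intro N μ hMod hN η hη hη1 hL hlog
  have hN' : (0 : ℝ) < N := by exact_mod_cast hN
  have hN1 : (1 : ℝ) ≤ N := by exact_mod_cast hN
  have hLa : L₀ ≤ N * η := (le_max_left _ _).trans hL
  have hL' := (le_max_right _ _).trans hL
  have hLb : 512 ≤ N * η := (le_max_left _ _).trans hL'
  have hL'' := (le_max_right _ _).trans hL'
  have hLc : 32 * M ≤ √(N * η) := Real.le_sqrt_of_sq_le ((le_max_left _ _).trans hL'')
  have hLd : 384 ^ 2 ≤ √(N * η) := Real.le_sqrt_of_sq_le ((le_max_right _ _).trans hL'')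
  have hlog2 : ∀ L, N * η ≤ L → Real.log N ^ 2 ≤ √L := fun L hL => Real.le_sqrt_of_sq_le (by
    calc (Real.log N ^ 2) ^ 2 = Real.log N ^ 4 := by ring
      _ ≤ L := hlog.trans hL)
  have hlog3 : Real.log N ≤ 1 / 384 * √(N * η) := by
    apply log_small (by norm_num) (by linarith) (hlog2 _ le_rfl)
    norm_num at hLd ⊢
    exact hLd
  have hek : ∀ k : ℕ, k ≤ N ^ 3 → η ≤ etak N η k ∧ etak N η k ≤ 16 := by
    intro k hk
    have hk' : (k : ℝ) ≤ (N : ℝ) ^ 3 := by exact_mod_cast hk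
    have hN3 : (0 : ℝ) < (N : ℝ) ^ 3 := by positivity
    unfold etak
    have e1 : (16 - η) * k / (N : ℝ) ^ 3 ≤ 16 - η := by
      rw [div_le_iff₀ hN3]
      exact mul_le_mul_of_nonneg_left hk' (by linarith)
    have e2 : 0 ≤ (16 - η) * k / (N : ℝ) ^ 3 := div_nonneg (mul_nonneg (by linarith) (by positivity)) hN3.le
    constructor <;> linarith
  set S : ℕ → ℕ → Set (TT N → ℂ) := fun k j => {x | 2 * M / √(N * etak N η k) ≤ Lam (zz (Ej N κ j) (etak N η k)) x ∧
      Lam (zz (Ej N κ j) (etak N η k)) x ≤ 1 / 8} with hS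
  have hSm : ∀ k j, MeasurableSet (S k j) := fun k j =>
    (measurableSet_le measurable_const (Lam_meas _)).inter (measurableSet_le (Lam_meas _) measurable_const)
  set I := Finset.range (N ^ 3 + 1) with hI
  refine ⟨⋃ k ∈ I, ⋃ j ∈ I, S k j, ?_, ?_, ?_⟩
  · exact Finset.measurableSet_biUnion _ fun k _ => Finset.measurableSet_biUnion _ fun j _ => hSm k j
  · have h1 : ∀ k ∈ I, ∀ j ∈ I, (Measure.pi μ) (S k j) ≤ ENNReal.ofReal (Real.exp (1 - √(N * η) / 32)) := by
      intro k hk j hj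
      have hk' : k ≤ N ^ 3 := by rw [hI, Finset.mem_range] at hk; omega
      obtain ⟨ha, hb⟩ := hek k hk'
      have hmono : N * η ≤ N * etak N η k := by gcongr
      refine (h N μ hMod hN (Ej N κ j) (etak N η k) (Ej_abs hκ2 N j) (by linarith) hb (hLa.trans hmono)
        (hlog2 _ hmono)).trans ?_
      apply ENNReal.ofReal_le_ofReal
      apply Real.exp_le_exp.2
      have := Real.sqrt_le_sqrt hmono
      linarith
    calc _ ≤ ∑ k ∈ I, (Measure.pi μ) (⋃ j ∈ I, S k j) := measure_biUnion_finset_le _ _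
      _ ≤ ∑ k ∈ I, ∑ j ∈ I, (Measure.pi μ) (S k j) := Finset.sum_le_sum fun k _ => measure_biUnion_finset_le _ _
      _ ≤ ∑ k ∈ I, ∑ j ∈ I, ENNReal.ofReal (Real.exp (1 - √(N * η) / 32)) :=
        Finset.sum_le_sum fun k hk => Finset.sum_le_sum fun j hj => h1 k hk j hj
      _ = ENNReal.ofReal (((N : ℝ) ^ 3 + 1) * ((N ^ 3 + 1) * Real.exp (1 - √(N * η) / 32))) := by
        rw [ENNReal.ofReal_mul (by positivity), ENNReal.ofReal_mul (by positivity)]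
        have e : ENNReal.ofReal ((N : ℝ) ^ 3 + 1) = ((N ^ 3 + 1 : ℕ) : ℝ≥0∞) := by
          rw [← ENNReal.ofReal_natCast]; push_cast; rfl
        rw [e]
        simp only [Finset.sum_const, hI, Finset.card_range, nsmul_eq_mul]
      _ ≤ _ := by
        apply ENNReal.ofReal_le_ofReal
        have e1 : (N : ℝ) ^ 3 + 1 ≤ 2 * N ^ 3 := by
          have : (1 : ℝ) ≤ (N : ℝ) ^ 3 := one_le_pow₀ hN1
          linarith
        have e2 : (N : ℝ) ^ 6 ≤ Real.exp (√(N * η) / 64) := by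
          calc (N : ℝ) ^ 6 = Real.exp (6 * Real.log N) := by
                rw [mul_comm, Real.exp_mul, Real.exp_log hN']; norm_cast
            _ ≤ _ := Real.exp_le_exp.2 (by linarith)
        calc _ ≤ (2 * N ^ 3) * ((2 * N ^ 3) * Real.exp (1 - √(N * η) / 32)) := by gcongr
          _ = 4 * (N : ℝ) ^ 6 * Real.exp (1 - √(N * η) / 32) := by ring
          _ ≤ 4 * Real.exp (√(N * η) / 64) * Real.exp (1 - √(N * η) / 32) := by gcongr
          _ = 4 * (Real.exp (√(N * η) / 64) * Real.exp (1 - √(N * η) / 32)) := by ring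
          _ = 4 * (Real.exp 1 * Real.exp (-(√(N * η) / 64))) := by
            rw [← Real.exp_add, ← Real.exp_add]; congr 2; ring
          _ = _ := by ring
  · intro x hx E hE
    refine bootstrap hN hκ hκ2 hη hη1 hM hLb hLc x ?_ E hE
    intro k j hk hj hc
    apply hx
    simp only [Set.mem_iUnion]
    exact ⟨k, by rw [hI, Finset.mem_range]; omega, j, by rw [hI, Finset.mem_range]; omega, hc⟩

lemma aem_of_map {Ω : Type*} [MeasurableSpace Ω] {P : Measure Ω} {β : Type*} [MeasurableSpace β] {f : Ω → β}
    {ν : Measure β} [IsProbabilityMeasure ν] (h : P.map f = ν) : AEMeasurable f P := by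
  by_contra hc
  rw [Measure.map_of_not_aemeasurable hc] at h
  have := measure_univ (μ := ν)
  rw [← h] at this
  simp at this

lemma entry_aem {Ω : Type} [MeasurableSpace Ω] {P : Measure Ω} {N : ℕ} {H : Ω → Matrix (Fin N) (Fin N) ℂ}
    {ν : Measure ℂ} {ν' : Measure ℝ} (hN : 0 < N) (hW : IsWignerMatrix P N H ν ν') (p : TT N) :
    AEMeasurable (fun ω => H ω p.1.1 p.1.2) P := by
  have := hW.probν
  have := hW.probν'
  have hs : (√(N : ℝ) : ℝ) ≠ 0 := by
    have : (0 : ℝ) < N := by exact_mod_cast hN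
    positivity
  obtain ⟨⟨i, j⟩, hij⟩ := p
  simp only at hij ⊢
  rcases hij.lt_or_eq with h | h
  · have h1 := aem_of_map (hW.offdiag i j h)
    have h2 := h1.const_mul ((√(N : ℝ) : ℂ)⁻¹)
    refine h2.congr (Filter.Eventually.of_forall fun ω => ?_)
    have : (√(N : ℝ) : ℂ) ≠ 0 := by exact_mod_cast hs
    simp only
    field_simp
  · subst h
    have h1 := aem_of_map (hW.diag i)
    have h2 := Complex.measurable_ofReal.comp_aemeasurable (h1.const_mul ((√(N : ℝ))⁻¹))
    refine h2.congr (Filter.Eventually.of_forall fun ω => ?_)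
    simp only [Function.comp]
    rw [← mul_assoc, inv_mul_cancel₀ hs, one_mul]
    apply Complex.ext
    · simp
    · simp [hW.diag_real ω i]

lemma wigner_model {Ω : Type} [MeasurableSpace Ω] {P : Measure Ω} {N : ℕ} {H : Ω → Matrix (Fin N) (Fin N) ℂ}
    {ν : Measure ℂ} {ν' : Measure ℝ} {δ₀ D D' : ℝ} (hN : 0 < N) (hW : IsWignerMatrix P N H ν ν')
    (hC : CondC1 ν ν' δ₀ D D') :
    Model N (fun p => P.map (fun ω => H ω p.1.1 p.1.2)) δ₀ (max 1 (max D D')) := by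
  have := hW.prob
  have := hW.probν
  have := hW.probν'
  have ha := entry_aem hN hW
  have hmap : ∀ i j, ∀ h : i < j, (P.map (fun ω => H ω i j)).map (fun x => (√N : ℂ) * x) = ν := by
    intro i j h
    rw [AEMeasurable.map_map_of_aemeasurable (by fun_prop) (ha ⟨(i, j), h.le⟩), ← hW.offdiag i j h]
    rfl
  refine ⟨fun p => Measure.isProbabilityMeasure_map (ha p), hC.1, le_max_left _ _, ?_, ?_, ?_⟩
  · intro i j h
    rw [hmap i j h]
    refine ⟨inferInstance, hC.1, hW.mean, hC.2.1.trans (ENNReal.ofReal_le_ofReal ?_)⟩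
    exact (le_max_left _ _).trans (le_max_right _ _)
  · intro i j h
    rw [hmap i j h]
    exact hW.var
  · intro i
    have h1 := ha ⟨(i, i), le_refl i⟩
    simp only at h1 ⊢
    rw [lintegral_map' (measurable_ee_comp (by fun_prop)).aemeasurable h1]
    have h2 := aem_of_map (hW.diag i)
    have h3 : ∫⁻ x, ee (δ₀ * x ^ 2) ∂(P.map (fun ω => √N * (H ω i i).re)) = ∫⁻ ω, ee (δ₀ * (√N * (H ω i i).re) ^ 2) ∂P :=
      lintegral_map' (measurable_ee_comp (by fun_prop)).aemeasurable h2
    rw [← h3, hW.diag i]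
    refine hC.2.2.trans (ENNReal.ofReal_le_ofReal ?_)
    exact (le_max_right _ _).trans (le_max_right _ _)

lemma Hm_entries {N : ℕ} {A : Matrix (Fin N) (Fin N) ℂ} (hA : A.IsHermitian) (hd : ∀ i, (A i i).im = 0) :
    Hm (fun p : TT N => A p.1.1 p.1.2) = A := by
  ext i j
  simp only [Hm]
  rcases lt_trichotomy i j with h | h | h
  · simp [h]
  · subst h
    simp only [lt_self_iff_false, dite_false]
    apply Complex.ext <;> simp [hd i]
  · simp only [h, h.not_gt, dite_true, dite_false]
    have := congrFun (congrFun hA i) j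
    simpa [Matrix.conjTranspose_apply] using this

lemma main_case (κ δ₀ D D' : ℝ) (hκ : 0 < κ) (hκ2 : κ ≤ 2) (hδ₀ : 0 < δ₀) :
    ∃ C c : ℝ, 0 < C ∧ 0 < c ∧
    ∀ (N : ℕ) (Ω : Type) (_ : MeasurableSpace Ω) (P : Measure Ω)
      (H : Ω → Matrix (Fin N) (Fin N) ℂ) (ν : Measure ℂ) (ν' : Measure ℝ),
      2 ≤ N →
      IsWignerMatrix P N H ν ν' →
      CondC1 ν ν' δ₀ D D' →
      ∀ η : ℝ, (Real.log N) ^ 4 / N ≤ η → η ≤ 1 →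
      ∀ δ : ℝ, 0 < δ → δ ≤ 1 * κ →
        P {ω | δ ≤ ⨆ E ∈ Set.Icc (-2 + κ) (2 - κ),
            ‖stTrans (H ω) ((E : ℂ) + η * Complex.I)
              - mSC ((E : ℂ) + η * Complex.I)‖}
          ≤ ENNReal.ofReal (C * Real.exp (-(c * δ * Real.sqrt (N * η)))) := by
  obtain ⟨M, L₀, hM, hL₀, h⟩ := model_bound κ δ₀ (max 1 (max D D')) hκ hκ2 hδ₀ (le_max_left _ _)
  refine ⟨4 * Real.exp 1 * Real.exp (M + 2 * √L₀), 1 / 128, by positivity, by norm_num, ?_⟩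
  intro N Ω _ P H ν ν' hN2 hW hC η hη hη1 δ hδ hδκ
  have hN : 0 < N := by omega
  have hN' : (0 : ℝ) < N := by exact_mod_cast hN
  have := hW.prob
  have hlogpos : 0 < Real.log N := Real.log_pos (by exact_mod_cast (by omega : 1 < N))
  have hη0 : 0 < η := lt_of_lt_of_le (by positivity) hη
  have hlog : Real.log N ^ 4 ≤ N * η := by
    rw [div_le_iff₀ hN'] at hη; linarith
  set s := √(N * η) with hs
  have hs0 : 0 < s := Real.sqrt_pos.2 (by positivity)
  have he1 : (1 : ℝ) ≤ Real.exp 1 := Real.one_le_exp (by norm_num)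
  have hK : (1 : ℝ) ≤ Real.exp (M + 2 * √L₀) := Real.one_le_exp (by positivity)
  by_cases hcase : L₀ ≤ N * η ∧ M < δ * s
  · obtain ⟨hcL, hcM⟩ := hcase
    obtain ⟨Bad, hBm, hBad, hgood⟩ := h N _ (wigner_model hN hW hC) hN η hη0 hη1 hcL hlog
    have ha := entry_aem hN hW
    have hpi := (iIndepFun_iff_map_fun_eq_pi_map ha).1 hW.indep
    rw [← hpi, Measure.map_apply_of_aemeasurable (aemeasurable_pi_lambda _ ha) hBm] at hBad
    refine (measure_mono ?_).trans (hBad.trans (ENNReal.ofReal_le_ofReal ?_))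
    · intro ω hω
      by_contra hc
      have h1 := hgood _ hc
      have h2 : M / s < δ := by rw [div_lt_iff₀ hs0]; exact hcM
      have h3 : (⨆ E ∈ Set.Icc (-2 + κ) (2 - κ),
            ‖stTrans (H ω) ((E : ℂ) + η * Complex.I)
              - mSC ((E : ℂ) + η * Complex.I)‖) ≤ M / s := by
        refine Real.iSup_le (fun E => Real.iSup_le (fun hE => ?_) (by positivity)) (by positivity)
        have h4 := h1 E hE
        rw [Lam, Hm_entries (hW.herm ω) (hW.diag_real ω)] at h4
        exact h4
      exact absurd (lt_of_le_of_lt h3 h2) (not_lt.2 hω)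
    · have e1 : Real.exp (-(s / 64)) ≤ Real.exp (-(1 / 128 * δ * s)) := by
        apply Real.exp_le_exp.2
        nlinarith
      calc 4 * Real.exp 1 * Real.exp (-(s / 64)) ≤ 4 * Real.exp 1 * 1 * Real.exp (-(1 / 128 * δ * s)) := by
            rw [mul_one]; gcongr
        _ ≤ _ := by gcongr
  · refine prob_le_one.trans ?_
    rw [ENNReal.one_le_ofReal]
    have hb : δ * s ≤ M + 2 * √L₀ := by
      by_cases hc1 : L₀ ≤ N * η
      · have : ¬ M < δ * s := fun hh => hcase ⟨hc1, hh⟩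
        push Not at this
        have : 0 ≤ √L₀ := Real.sqrt_nonneg _
        linarith
      · push Not at hc1
        have e1 : s ≤ √L₀ := Real.sqrt_le_sqrt hc1.le
        have : δ * s ≤ 2 * √L₀ := by
          apply mul_le_mul (by linarith) e1 hs0.le (by norm_num)
        linarith
    have e2 : 1 ≤ Real.exp (M + 2 * √L₀) * Real.exp (-(1 / 128 * δ * s)) := by
      rw [← Real.exp_add]
      apply Real.one_le_exp
      have : 0 < δ * s := by positivity
      nlinarith
    calc (1 : ℝ) ≤ 4 * Real.exp 1 * 1 := by linarith
      _ ≤ 4 * Real.exp 1 * (Real.exp (M + 2 * √L₀) * Real.exp (-(1 / 128 * δ * s))) := by gcongr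
      _ = _ := by ring

/-- **Semicircle law on intermediate scales, uniform in the energy.** -/
theorem stmt_11 :
    ∃ c₁ : ℝ, 0 < c₁ ∧
    ∀ κ δ₀ D D' : ℝ, 0 < κ →
    ∃ C c : ℝ, 0 < C ∧ 0 < c ∧
    ∀ (N : ℕ) (Ω : Type) (_ : MeasurableSpace Ω) (P : Measure Ω)
      (H : Ω → Matrix (Fin N) (Fin N) ℂ) (ν : Measure ℂ) (ν' : Measure ℝ),
      2 ≤ N →
      IsWignerMatrix P N H ν ν' →
      CondC1 ν ν' δ₀ D D' →
      ∀ η : ℝ, (Real.log N) ^ 4 / N ≤ η → η ≤ 1 →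
      ∀ δ : ℝ, 0 < δ → δ ≤ c₁ * κ →
        P {ω | δ ≤ ⨆ E ∈ Set.Icc (-2 + κ) (2 - κ),
            ‖stTrans (H ω) ((E : ℂ) + η * Complex.I)
              - mSC ((E : ℂ) + η * Complex.I)‖}
          ≤ ENNReal.ofReal (C * Real.exp (-(c * δ * Real.sqrt (N * η)))) := by
  refine ⟨1, one_pos, ?_⟩
  intro κ δ₀ D D' hκ
  by_cases hδ₀ : 0 < δ₀
  · by_cases hκ2 : κ ≤ 2
    · exact main_case κ δ₀ D D' hκ hκ2 hδ₀
    · refine ⟨1, 1, one_pos, one_pos, ?_⟩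
      intro N Ω _ P H ν ν' hN hW hC η _ _ δ hδ _
      have hempty : {ω | δ ≤ ⨆ E ∈ Set.Icc (-2 + κ) (2 - κ),
            ‖stTrans (H ω) ((E : ℂ) + η * Complex.I)
              - mSC ((E : ℂ) + η * Complex.I)‖} = (∅ : Set Ω) := by
        ext ω
        simp only [Set.mem_setOf_eq, Set.mem_empty_iff_false, iff_false, not_le]
        refine lt_of_le_of_lt ?_ hδ
        refine Real.iSup_le (fun E => Real.iSup_le (fun hE => ?_) le_rfl) le_rfl
        exfalso
        push Not at hκ2
        linarith [hE.1, hE.2]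
      rw [hempty, measure_empty]
      exact zero_le
  · refine ⟨1, 1, one_pos, one_pos, ?_⟩
    intro N Ω _ P H ν ν' hN hW hC
    exact absurd hC.1 hδ₀

end
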